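/- arXiv:2306.14989 — 3 statements merged into one kernel-verified Lean document; each statement's English description precedes it below -/
import Mathlib

section
/- Let R be a Cohen–Macaulay local ring with canonical module K, and let C be a semidualizing R-module (i.e., the homothety map R → Hom_R(C,C) is an isomorphism and Ext^i_R(C,C)=0 for all i>0). Then the number of minimal generators of C times the number of minimal generators of Hom_R(C,K) equals the Cohen–Macaulay type of R. -/
open CategoryTheory IsLocalRing

/-- The `i`-th Ext group `Ext_R^i(M, N)`. -/
noncomputable abbrev extGroup (R : Type) [CommRing R] (M N : Type) [AddCommGroup M]
    [Module R M] [AddCommGroup N] [Module R N] (i : ℕ) : Type :=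
  ((Ext R (ModuleCat.{0} R) i).obj (Opposite.op (ModuleCat.of R M))).obj (ModuleCat.of R N)

/-- A finitely generated module `C` is semidualizing if the homothety map
`R → Hom_R(C,C)` is bijective and `Ext^i_R(C,C) = 0` for all `i > 0`. -/
def IsSemidualizing (R : Type) [CommRing R] (C : Type) [AddCommGroup C] [Module R C] : Prop :=
  Module.Finite R C ∧ Function.Bijective (LinearMap.lsmul R C) ∧
    ∀ i : ℕ, 0 < i → Subsingleton (extGroup R C C i)

/-- `K` has finite injective dimension over `R`. -/
def HasFiniteInjDim (R : Type) [CommRing R] (K : Type) [AddCommGroup K] [Module R K] : Prop :=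
  ∃ n : ℕ, ∀ (M : Type) [AddCommGroup M] [Module R M], ∀ i : ℕ, n < i →
    Subsingleton (extGroup R M K i)

/-- A canonical module of a Cohen–Macaulay local ring: a semidualizing module of
finite injective dimension. -/
def IsCanonicalModule (R : Type) [CommRing R] (K : Type) [AddCommGroup K] [Module R K] : Prop :=
  IsSemidualizing R K ∧ HasFiniteInjDim R K

/-- The depth of a local ring, via vanishing of `Ext(k, R)`. -/
noncomputable def ringDepth (R : Type) [CommRing R] [IsLocalRing R] : ℕ :=
  sInf {i : ℕ | ¬ Subsingleton (extGroup R (ResidueField R) R i)}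

/-- A local ring is Cohen–Macaulay if its depth equals its Krull dimension. -/
def IsCMLocal (R : Type) [CommRing R] [IsLocalRing R] : Prop :=
  ringKrullDim R = ((ringDepth R : ℕ∞) : WithBot ℕ∞)

/-- Minimal number of generators of a module. -/
noncomputable def mu (R : Type) [Semiring R] (M : Type) [AddCommGroup M] [Module R M] : ℕ :=
  sInf {n : ℕ | ∃ s : Finset M, s.card = n ∧ Submodule.span R (s : Set M) = ⊤}


namespace SemiDual

noncomputable section

variable {R : Type} [CommRing R]

/-- The `Ext` group defined through the derived category. -/
abbrev E (R : Type) [CommRing R] (M N : Type) [AddCommGroup M] [Module R M] [AddCommGroup N]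
    [Module R N] (i : ℕ) : Type :=
  Abelian.Ext (ModuleCat.of R M) (ModuleCat.of R N) i

variable {M M' M'' N : Type} [AddCommGroup M] [Module R M] [AddCommGroup M'] [Module R M']
  [AddCommGroup M''] [Module R M''] [AddCommGroup N] [Module R N]

lemma bridge (i : ℕ) (h : Subsingleton (extGroup R M N (i + 1))) :
    Subsingleton (E R M N (i + 1)) := by
  let P := projectiveResolution (ModuleCat.of R M)
  have h1 : Limits.IsZero ((P.complex.linearYonedaObj R (ModuleCat.of R N)).homology (i+1)) := by
    refine Limits.IsZero.of_iso ?_ (P.isoExt (R := R) (i+1) (ModuleCat.of R N)).symm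
    exact ModuleCat.isZero_of_subsingleton _
  rw [← HomologicalComplex.exactAt_iff_isZero_homology,
    HomologicalComplex.exactAt_iff' _ i (i+1) (i+2) (by simp) (by simp),
    ShortComplex.moduleCat_exact_iff] at h1
  refine subsingleton_of_forall_eq 0 fun α => ?_
  obtain ⟨f, hf, rfl⟩ := P.extMk_surjective α (i+2) rfl
  rw [P.extMk_eq_zero_iff f (i+2) rfl hf i rfl]
  exact h1 f hf

/-- Pullback on Ext. -/
def pb (N : Type) [AddCommGroup N] [Module R N] (i : ℕ) (f : M →ₗ[R] M') :
    E R M' N i →ₗ[R] E R M N i :=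
  (Abelian.Ext.mk₀ (ModuleCat.ofHom f)).precompOfLinear R (ModuleCat.of R N) (zero_add i)

lemma pb_apply (i : ℕ) (f : M →ₗ[R] M') (x : E R M' N i) :
    pb N i f x = (Abelian.Ext.mk₀ (ModuleCat.ofHom f)).comp x (zero_add i) := rfl

lemma pb_id (i : ℕ) (x : E R M N i) : pb N i (LinearMap.id : M →ₗ[R] M) x = x := by
  rw [pb_apply]
  exact Abelian.Ext.mk₀_id_comp x

lemma pb_comp (i : ℕ) (f : M →ₗ[R] M') (g : M' →ₗ[R] M'') (x : E R M'' N i) :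
    pb N i (g ∘ₗ f) x = pb N i f (pb N i g x) := by
  simp only [pb_apply, ModuleCat.ofHom_comp]
  exact (Abelian.Ext.mk₀_comp_mk₀_assoc _ _ _).symm

lemma pb_smul (i : ℕ) (a : R) (f : M →ₗ[R] M') (x : E R M' N i) :
    pb N i (a • f) x = a • pb N i f x := by
  have : ModuleCat.ofHom (a • f) = a • ModuleCat.ofHom f := rfl
  simp only [pb_apply, this, Abelian.Ext.mk₀_smul, Abelian.Ext.smul_comp]

lemma pb_zero (i : ℕ) (x : E R M' N i) : pb N i (0 : M →ₗ[R] M') x = 0 := by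
  simpa using pb_smul i (0:R) (0 : M →ₗ[R] M') x

lemma pb_add (i : ℕ) (f g : M →ₗ[R] M') (x : E R M' N i) :
    pb N i (f + g) x = pb N i f x + pb N i g x := by
  have : ModuleCat.ofHom (f + g) = ModuleCat.ofHom f + ModuleCat.ofHom g := rfl
  simp only [pb_apply, this, Abelian.Ext.mk₀_add, Abelian.Ext.add_comp]

lemma pb_sum {ι : Type} (s : Finset ι) (i : ℕ) (f : ι → M →ₗ[R] M') (x : E R M' N i) :
    pb N i (∑ j ∈ s, f j) x = ∑ j ∈ s, pb N i (f j) x := by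
  classical
  induction s using Finset.induction with
  | empty => simp [pb_zero]
  | insert a s ha ih => rw [Finset.sum_insert ha, Finset.sum_insert ha, pb_add, ih]

/-- The short complex. -/
abbrev sc (f : M →ₗ[R] M') (g : M' →ₗ[R] M'') (h : Function.Exact f g) :
    ShortComplex (ModuleCat.{0} R) :=
  ShortComplex.mk (ModuleCat.ofHom f) (ModuleCat.ofHom g) (by
    ext x; exact h.apply_apply_eq_zero x)

lemma sc_se (f : M →ₗ[R] M') (g : M' →ₗ[R] M'') (h : Function.Exact f g)
    (hf : Function.Injective f) (hg : Function.Surjective g) : (sc f g h).ShortExact where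
  exact := by
    rw [ShortComplex.moduleCat_exact_iff]
    intro x hx
    exact (h x).1 hx
  mono_f := (ModuleCat.mono_iff_injective _).2 hf
  epi_g := (ModuleCat.epi_iff_surjective _).2 hg

section
variable (f : M →ₗ[R] M') (g : M' →ₗ[R] M'') (h : Function.Exact f g)
    (hf : Function.Injective f) (hg : Function.Surjective g)

include h hf hg

lemma pb_surj (i : ℕ) (h0 : Subsingleton (E R M'' N (i+1))) : Function.Surjective (pb N i f) := by
  intro x
  exact Abelian.Ext.contravariant_sequence_exact₁ (sc_se f g h hf hg) (ModuleCat.of R N) x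
    (add_comm 1 i) (Subsingleton.elim (α := E R M'' N (i+1)) _ _)

lemma pb_exact (i : ℕ) (x : E R M' N i) (hx : pb N i f x = 0) : ∃ y, pb N i g y = x :=
  Abelian.Ext.contravariant_sequence_exact₂ (sc_se f g h hf hg) (ModuleCat.of R N) x hx

lemma sub_left (i : ℕ) (h0 : Subsingleton (E R M'' N (i+1))) (h1 : Subsingleton (E R M' N i)) :
    Subsingleton (E R M N i) :=
  (pb_surj f g h hf hg i h0).subsingleton

lemma sub_right (i : ℕ) (h0 : Subsingleton (E R M N i)) (h1 : Subsingleton (E R M' N (i+1))) :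
    Subsingleton (E R M'' N (i+1)) := by
  refine subsingleton_of_forall_eq 0 fun x => ?_
  obtain ⟨y, rfl⟩ := Abelian.Ext.contravariant_sequence_exact₃ (sc_se f g h hf hg)
    (ModuleCat.of R N) x (Subsingleton.elim (α := E R M' N (i+1)) _ _) (add_comm 1 i)
  rw [Subsingleton.elim (α := E R M N i) y 0]
  simp

lemma hom_ext (h0 : Subsingleton (E R M'' N 1)) (u : M →ₗ[R] N) : ∃ v : M' →ₗ[R] N, v ∘ₗ f = u := by
  obtain ⟨y, hy⟩ := pb_surj f g h hf hg 0 h0 (Abelian.Ext.mk₀ (ModuleCat.ofHom u))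
  obtain ⟨v, rfl⟩ := (Abelian.Ext.mk₀_bijective _ _).2 y
  refine ⟨v.hom, ?_⟩
  rw [pb_apply, Abelian.Ext.mk₀_comp_mk₀] at hy
  have := (Abelian.Ext.mk₀_bijective _ _).1 hy
  exact congrArg ModuleCat.Hom.hom this

end

lemma sub_proj [Module.Projective R M] (i : ℕ) : Subsingleton (E R M N (i+1)) := 
  haveI : Projective (ModuleCat.of R M) := inferInstance
  Abelian.Ext.subsingleton_of_projective _ _ _

lemma e_fin [IsNoetherianRing R] [Module.Finite R M] [Module.Finite R N] (i : ℕ) :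
    Module.Finite R (E R M N i) :=
  ModuleCat.finite_ext R _ _ i


lemma hom_free_sub (C K : Type) [AddCommGroup C] [Module R C] [AddCommGroup K] [Module R K]
    (b i : ℕ) (h : Subsingleton (E R C K i)) :
    Subsingleton (E R ((Fin b → R) →ₗ[R] C) K i) := by
  refine subsingleton_of_forall_eq 0 fun x => ?_
  have key : (LinearMap.id : ((Fin b → R) →ₗ[R] C) →ₗ[R] ((Fin b → R) →ₗ[R] C)) =
      ∑ j : Fin b, (LinearMap.smulRightₗ (LinearMap.proj j : (Fin b → R) →ₗ[R] R)) ∘ₗ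
        (LinearMap.applyₗ (Pi.single j (1:R) : Fin b → R)) := by
    ext f j
    simp [Pi.single_apply]
  rw [← pb_id i x, key, pb_sum]
  refine Finset.sum_eq_zero fun j _ => ?_
  rw [pb_comp, Subsingleton.elim (α := E R C K i) (pb K i _ x) 0, map_zero]

section dual
variable (C : Type) [AddCommGroup C] [Module R C]
variable {F : Type} [AddCommGroup F] [Module R F] (p : F →ₗ[R] M) (hp : Function.Surjective p)

include hp

lemma lcomp_inj : Function.Injective (LinearMap.lcomp R C p) := by
  intro u v h
  ext x
  obtain ⟨y, rfl⟩ := hp x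
  exact LinearMap.congr_fun h y

lemma lcomp_exact :
    Function.Exact (LinearMap.lcomp R C p) (LinearMap.lcomp R C (LinearMap.ker p).subtype) := by
  intro u
  constructor
  · intro hu
    have hk : LinearMap.ker p ≤ LinearMap.ker u := fun x hx => LinearMap.congr_fun hu ⟨x, hx⟩
    refine ⟨((LinearMap.ker p).liftQ u hk) ∘ₗ
      (p.quotKerEquivOfSurjective hp).symm.toLinearMap, ?_⟩
    ext x
    have : (p.quotKerEquivOfSurjective hp).symm (p x) = (LinearMap.ker p).mkQ x := by
      rw [LinearEquiv.symm_apply_eq]; rfl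
    simp [this]
  · rintro ⟨v, rfl⟩
    ext x
    simp

lemma ker_ses_sub (i : ℕ) [Module.Projective R F] (h : Subsingleton (E R M C (i+2))) :
    Subsingleton (E R (LinearMap.ker p) C (i+1)) :=
  sub_left (LinearMap.ker p).subtype p (LinearMap.exact_subtype_ker_map p)
    (Submodule.subtype_injective _) hp (i+1) h (sub_proj i)

lemma lcomp_surj (h : Subsingleton (E R M C 1)) :
    Function.Surjective (LinearMap.lcomp R C (LinearMap.ker p).subtype) := fun u =>
  hom_ext (LinearMap.ker p).subtype p (LinearMap.exact_subtype_ker_map p)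
    (Submodule.subtype_injective _) hp h u

end dual

section main
variable [IsNoetherianRing R] {C K : Type} [AddCommGroup C] [Module R C] [AddCommGroup K]
  [Module R K]

lemma claim1 (n s : ℕ) (hn : ∀ (M : Type) [AddCommGroup M] [Module R M], ∀ i : ℕ, n < i →
      Subsingleton (E R M K i))
    (hs : ∀ i, s < i → Subsingleton (E R C K i)) (k : ℕ) :
    ∀ (M : Type) [AddCommGroup M] [Module R M] [Module.Finite R M],
      (∀ i, Subsingleton (E R M C (i+1))) → ∀ i, s < i → n < i + k →
      Subsingleton (E R (M →ₗ[R] C) K i) := by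
  induction k with
  | zero => intro M _ _ _ _ i _ hi; exact hn _ i hi
  | succ k ih =>
    intro M _ _ _ hM i hi hik
    obtain ⟨b, p, hp⟩ := Module.Finite.exists_fin' R M
    refine sub_left _ _ (lcomp_exact C p hp) (lcomp_inj C p hp) (lcomp_surj C p hp (hM 0)) i ?_
      (hom_free_sub C K b i (hs i hi))
    exact ih (LinearMap.ker p) (fun j => ker_ses_sub C p hp j (hM (j+1))) (i+1) (by omega)
      (by omega)

/-- A surjective functional on `R^b`, whose reduction factors through `p`. -/
lemma exists_functional [IsLocalRing R] [Module.Finite R C] [Nontrivial C] (b : ℕ)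
    (p : (Fin b → R) →ₗ[R] C) (hp : Function.Surjective p) :
    ∃ u : (Fin b → R) →ₗ[R] R, (∃ x, u x = 1) ∧ ∀ x, p x = 0 → u x ∈ maximalIdeal R := by
  obtain ⟨π, hπ⟩ : ∃ π : C →ₗ[R] ResidueField R, Function.Surjective π := by
    have : Nontrivial (TensorProduct R (ResidueField R) C) := by
      rw [← not_subsingleton_iff_nontrivial, IsLocalRing.subsingleton_tensorProduct,
        not_subsingleton_iff_nontrivial]
      infer_instance
    obtain ⟨t, ht⟩ := exists_ne (0 : TensorProduct R (ResidueField R) C)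
    obtain ⟨φ, hφ⟩ : ∃ φ : Module.Dual (ResidueField R) (TensorProduct R (ResidueField R) C),
        φ t ≠ 0 := by
      by_contra! hcon
      exact ht ((Module.forall_dual_apply_eq_zero_iff (ResidueField R) t).1 hcon)
    have h2 : ∃ c, φ (1 ⊗ₜ c) ≠ 0 := by
      by_contra! hcon
      apply hφ
      have : φ = 0 := by
        apply TensorProduct.AlgebraTensorModule.ext
        intro a c
        have : a ⊗ₜ[R] c = a • ((1 : ResidueField R) ⊗ₜ[R] c) := by
          rw [TensorProduct.smul_tmul', smul_eq_mul, mul_one]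
        rw [this, map_smul, hcon]; simp
      rw [this]; rfl
    obtain ⟨c, hc⟩ := h2
    refine ⟨(φ.restrictScalars R) ∘ₗ (TensorProduct.mk R (ResidueField R) C 1), fun y => ?_⟩
    obtain ⟨r, hr⟩ := IsLocalRing.residue_surjective (y * (φ (1 ⊗ₜ c))⁻¹)
    refine ⟨r • c, ?_⟩
    rw [map_smul, Algebra.smul_def]
    change residue R r * φ (1 ⊗ₜ c) = y
    rw [hr]; field_simp
  obtain ⟨u, hu⟩ := Module.projective_lifting_property
    (Algebra.linearMap R (ResidueField R)) (π ∘ₗ p) IsLocalRing.residue_surjective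
  have hu' : ∀ x, residue R (u x) = π (p x) := fun x => LinearMap.congr_fun hu x
  refine ⟨u, ?_, ?_⟩
  · obtain ⟨c, hc⟩ := hπ 1
    obtain ⟨x, rfl⟩ := hp c
    have : IsUnit (u x) := by
      rw [← IsLocalRing.residue_ne_zero_iff_isUnit, hu', hc]; exact one_ne_zero
    obtain ⟨v, hv⟩ := this
    exact ⟨(↑v⁻¹ : R) • x, by rw [map_smul, ← hv]; simp⟩
  · intro x hx
    rw [← IsLocalRing.residue_eq_zero_iff, hu', hx, map_zero]

lemma claim2 [IsLocalRing R] [Module.Finite R C] [Nontrivial C] [Module.Finite R K] (n s : ℕ)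
    (hn : ∀ (M : Type) [AddCommGroup M] [Module R M], ∀ i : ℕ, n < i → Subsingleton (E R M K i))
    (hC : ∀ i, Subsingleton (E R C C (i+1)))
    (hb : Function.Bijective (LinearMap.lsmul R C))
    (hs : ∀ i, s + 1 < i → Subsingleton (E R C K i)) : Subsingleton (E R C K (s+1)) := by
  obtain ⟨b, p, hp⟩ := Module.Finite.exists_fin' R C
  obtain ⟨u, ⟨x₀, hx₀⟩, hu⟩ := exists_functional b p hp
  obtain ⟨b1, q, hq⟩ := Module.Finite.exists_fin' R (LinearMap.ker p)
  have hM' := fun j => ker_ses_sub C p hp j (hC (j+1))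
  have hM'' := fun j => ker_ses_sub C q hq j (hM' (j+1))
  have hCC : Subsingleton (E R (C →ₗ[R] C) K (s+1)) := by
    have : Module.Projective R (C →ₗ[R] C) :=
      Module.Projective.of_equiv (LinearEquiv.ofBijective (LinearMap.lsmul R C) hb)
    exact sub_proj s
  have e1 : ∀ t : E R ((Fin b → R) →ₗ[R] C) K (s+1),
      ∃ t', pb K (s+1) (LinearMap.lcomp R C (LinearMap.ker p).subtype) t' = t := fun t =>
    pb_exact _ _ (lcomp_exact C p hp) (lcomp_inj C p hp) (lcomp_surj C p hp (hC 0)) (s+1) t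
      (Subsingleton.elim (α := E R (C →ₗ[R] C) K (s+1)) _ _)
  have e2 : Function.Surjective (pb K (s+1) (LinearMap.lcomp R C q)) := by
    refine pb_surj _ _ (lcomp_exact C q hq) (lcomp_inj C q hq) (lcomp_surj C q hq (hM' 0)) (s+1) ?_
    exact claim1 n (s+1) hn hs n (LinearMap.ker q) hM'' (s+2) (by omega) (by omega)
  have : Module.Finite R (E R C K (s+1)) := e_fin (s+1)
  have top : (⊤ : Submodule R (E R C K (s+1))) ≤
      maximalIdeal R • (⊤ : Submodule R (E R C K (s+1))) := by
    intro t _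
    obtain ⟨t1, ht1⟩ := e1 (pb K (s+1) (LinearMap.applyₗ x₀) t)
    obtain ⟨t2, rfl⟩ := e2 t1
    have h1 : (LinearMap.applyₗ x₀ : ((Fin b → R) →ₗ[R] C) →ₗ[R] C) ∘ₗ (LinearMap.smulRightₗ u)
        = LinearMap.id := by
      ext c; simp [hx₀]
    have h2 : LinearMap.lcomp R C q ∘ₗ LinearMap.lcomp R C (LinearMap.ker p).subtype ∘ₗ
        (LinearMap.smulRightₗ u : C →ₗ[R] ((Fin b → R) →ₗ[R] C)) =
        ∑ j : Fin b1, u (q (Pi.single j 1)) •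
          (LinearMap.smulRightₗ (LinearMap.proj j : (Fin b1 → R) →ₗ[R] R)) := by
      ext c j
      simp [Pi.single_apply]
    have h3 : t = ∑ j : Fin b1, u (q (Pi.single j 1)) •
        pb K (s+1) (LinearMap.smulRightₗ (LinearMap.proj j : (Fin b1 → R) →ₗ[R] R)) t2 := by
      conv_lhs => rw [← pb_id (s+1) t, ← h1, pb_comp, ← ht1, ← pb_comp, ← pb_comp, h2, pb_sum]
      simp only [pb_smul]
    rw [h3]
    refine Submodule.sum_mem _ fun j _ => Submodule.smul_mem_smul (hu _ (q _).2) trivial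
  have := Submodule.eq_bot_of_le_smul_of_le_jacobson_bot (maximalIdeal R) _ Module.Finite.fg_top
    top (IsLocalRing.maximalIdeal_le_jacobson _)
  exact (Submodule.subsingleton_iff R).1 (subsingleton_of_bot_eq_top this.symm)

lemma claim3 [IsLocalRing R] [Module.Finite R C] [Nontrivial C] [Module.Finite R K] (n : ℕ)
    (hn : ∀ (M : Type) [AddCommGroup M] [Module R M], ∀ i : ℕ, n < i → Subsingleton (E R M K i))
    (hC : ∀ i, Subsingleton (E R C C (i+1)))
    (hb : Function.Bijective (LinearMap.lsmul R C)) :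
    ∀ i, Subsingleton (E R C K (i+1)) := by
  have : ∀ k s, n ≤ s + k → ∀ i, s < i → Subsingleton (E R C K i) := by
    intro k
    induction k with
    | zero => intro s hs i hi; exact hn C i (by omega)
    | succ k ih =>
      intro s hs i hi
      have h1 := ih (s+1) (by omega)
      rcases Nat.lt_or_ge (s+1) i with h | h
      · exact h1 i h
      · obtain rfl : i = s + 1 := by omega
        exact claim2 n s hn hC hb h1
  exact fun i => this n 0 (by omega) (i+1) (by omega)


open TensorProduct

/-- The evaluation map. -/
def theta (C K M : Type) [AddCommGroup C] [Module R C] [AddCommGroup K] [Module R K]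
    [AddCommGroup M] [Module R M] :
    M ⊗[R] (C →ₗ[R] K) →ₗ[R] ((M →ₗ[R] C) →ₗ[R] K) :=
  TensorProduct.lift
    ((LinearMap.llcomp R (M →ₗ[R] C) C K).flip ∘ₗ (LinearMap.applyₗ : M →ₗ[R] (M →ₗ[R] C) →ₗ[R] C))

lemma theta_tmul (m : M) (φ : C →ₗ[R] K) (f : M →ₗ[R] C) :
    theta C K M (m ⊗ₜ φ) f = φ (f m) := rfl

lemma theta_nat (g : M →ₗ[R] M') (t : M ⊗[R] (C →ₗ[R] K)) :
    theta C K M' (g.rTensor _ t) = theta C K M t ∘ₗ LinearMap.lcomp R C g := by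
  induction t with
  | zero => simp
  | add x y hx hy => simp only [map_add, hx, hy, LinearMap.add_comp]
  | tmul m φ => ext f; simp [theta_tmul]

lemma theta_free (b : ℕ) : Function.Bijective (theta (R := R) C K (Fin b → R)) := by
  let inv : (((Fin b → R) →ₗ[R] C) →ₗ[R] K) → (Fin b → R) ⊗[R] (C →ₗ[R] K) := fun g =>
    ∑ j : Fin b, (Pi.single j (1:R) : Fin b → R) ⊗ₜ
      (g ∘ₗ LinearMap.smulRightₗ (LinearMap.proj j : (Fin b → R) →ₗ[R] R))
  refine Function.bijective_iff_has_inverse.2 ⟨inv, fun t => ?_, fun g => ?_⟩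
  · induction t with
    | zero => simp [inv]
    | add x y hx hy =>
      conv_rhs => rw [← hx, ← hy]
      simp only [inv, map_add, LinearMap.add_comp, TensorProduct.tmul_add, Finset.sum_add_distrib]
    | tmul m φ =>
      have : ∀ j, theta C K (Fin b → R) (m ⊗ₜ φ) ∘ₗ
          LinearMap.smulRightₗ (LinearMap.proj j : (Fin b → R) →ₗ[R] R) = m j • φ := by
        intro j; ext c; simp [theta_tmul]
      simp only [inv, this, TensorProduct.tmul_smul]
      simp only [TensorProduct.smul_tmul', ← TensorProduct.sum_tmul]
      congr 1
      ext j
      simp [Finset.sum_apply, Pi.single_apply]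
  · refine LinearMap.ext fun f => ?_
    have key : f = ∑ j : Fin b, LinearMap.smulRightₗ (LinearMap.proj j : (Fin b → R) →ₗ[R] R)
        (f (Pi.single j (1:R))) := by
      ext j
      simp [Pi.single_apply]
    simp only [inv, map_sum, LinearMap.sum_apply, theta_tmul]
    conv_rhs => rw [key, map_sum]
    rfl

lemma theta_bij [Module.Finite R C] (n : ℕ)
    (hn : ∀ (M : Type) [AddCommGroup M] [Module R M], ∀ i : ℕ, n < i → Subsingleton (E R M K i))
    (hC : ∀ i, Subsingleton (E R C C (i+1)))
    (hK : ∀ i, Subsingleton (E R C K (i+1))) : Function.Bijective (theta (R := R) C K C) := by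
  have hs : ∀ i, 0 < i → Subsingleton (E R C K i) := by
    intro i hi
    obtain ⟨j, rfl⟩ : ∃ j, i = j + 1 := ⟨i - 1, by omega⟩
    exact hK j
  obtain ⟨b, p, hp⟩ := Module.Finite.exists_fin' R C
  obtain ⟨b1, q, hq⟩ := Module.Finite.exists_fin' R (LinearMap.ker p)
  have hM' := fun j => ker_ses_sub C p hp j (hC (j+1))
  have hM'' := fun j => ker_ses_sub C q hq j (hM' (j+1))
  have z' : Subsingleton (E R (LinearMap.ker p →ₗ[R] C) K 1) :=
    claim1 n 0 hn hs n _ hM' 1 (by omega) (by omega)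
  have z'' : Subsingleton (E R (LinearMap.ker q →ₗ[R] C) K 1) :=
    claim1 n 0 hn hs n _ hM'' 1 (by omega) (by omega)
  constructor
  · rw [injective_iff_map_eq_zero]
    intro t ht
    obtain ⟨t', rfl⟩ := LinearMap.rTensor_surjective (C →ₗ[R] K) hp t
    rw [theta_nat] at ht
    have sur := lcomp_surj C p hp (hC 0)
    obtain ⟨h, hh⟩ : ∃ h : (LinearMap.ker p →ₗ[R] C) →ₗ[R] K,
        h ∘ₗ LinearMap.lcomp R C (LinearMap.ker p).subtype = theta C K _ t' := by
      have hk : LinearMap.ker (LinearMap.lcomp R C (LinearMap.ker p).subtype) ≤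
          LinearMap.ker (theta C K _ t') := by
        intro f hf
        obtain ⟨g, rfl⟩ := (lcomp_exact C p hp f).1 hf
        exact LinearMap.congr_fun ht g
      have hk2 := (lcomp_exact K (LinearMap.lcomp R C (LinearMap.ker p).subtype) sur
        (theta C K _ t')).1 (by ext x; exact hk x.2)
      exact hk2
    obtain ⟨h', rfl⟩ := hom_ext _ _ (lcomp_exact C q hq) (lcomp_inj C q hq)
      (lcomp_surj C q hq (hM' 0)) z'' h
    obtain ⟨t'', rfl⟩ := (theta_free b1).2 h'
    have : t' = ((LinearMap.ker p).subtype ∘ₗ q).rTensor _ t'' := by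
      apply (theta_free b).1
      rw [← hh, theta_nat]
      rfl
    rw [this, ← LinearMap.comp_apply, ← LinearMap.rTensor_comp]
    have h0 : p ∘ₗ (LinearMap.ker p).subtype ∘ₗ q = 0 := by
      ext x; simp
    rw [h0]; simp
  · intro g
    obtain ⟨g', rfl⟩ := hom_ext _ _ (lcomp_exact C p hp) (lcomp_inj C p hp)
      (lcomp_surj C p hp (hC 0)) z' g
    obtain ⟨t, rfl⟩ := (theta_free b).2 g'
    exact ⟨p.rTensor _ t, theta_nat p t⟩

lemma mu_eq [IsLocalRing R] (M : Type) [AddCommGroup M] [Module R M] [Module.Finite R M] :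
    mu R M = Module.finrank (ResidueField R) (ResidueField R ⊗[R] M) := by
  classical
  apply le_antisymm
  · let w := Module.finBasis (ResidueField R) (ResidueField R ⊗[R] M)
    obtain ⟨v, hv⟩ := (TensorProduct.mk_surjective R M (ResidueField R)
      Ideal.Quotient.mk_surjective).comp_left w
    have hsp := span_eq_top_of_tmul_eq_basis v w (congr_fun hv)
    have hmem : (Finset.univ.image v).card ∈
        {n : ℕ | ∃ s : Finset M, s.card = n ∧ Submodule.span R (s : Set M) = ⊤} :=
      ⟨Finset.univ.image v, rfl, by simpa using hsp⟩
    exact (Nat.sInf_le hmem).trans (Finset.card_image_le.trans (by simp))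
  · refine le_csInf ?_ ?_
    · obtain ⟨s, hs⟩ := Module.Finite.fg_top (R := R) (M := M)
      exact ⟨_, s, rfl, hs⟩
    · rintro _ ⟨s, rfl, hs⟩
      have h1 := Submodule.baseChange_span (R := R) (ResidueField R) (s : Set M)
      rw [hs, Submodule.baseChange_top] at h1
      have h2 : Submodule.span (ResidueField R)
          ((s.image (TensorProduct.mk R (ResidueField R) M 1) : Finset _) :
            Set (ResidueField R ⊗[R] M)) = ⊤ := by
        rw [h1]; simp
      have := finrank_span_finset_le_card (R := ResidueField R)
        (s.image (TensorProduct.mk R (ResidueField R) M 1))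
      rw [Set.finrank, h2, finrank_top] at this
      exact this.trans Finset.card_image_le

lemma mu_tensor [IsLocalRing R] (M N : Type) [AddCommGroup M] [Module R M] [Module.Finite R M]
    [AddCommGroup N] [Module R N] [Module.Finite R N] :
    mu R (M ⊗[R] N) = mu R M * mu R N := by
  rw [mu_eq, mu_eq, mu_eq, ← Module.finrank_tensorProduct]
  exact LinearEquiv.finrank_eq
    (TensorProduct.AlgebraTensorModule.distribBaseChange R (ResidueField R) M N)

lemma mu_congr [IsLocalRing R] (M N : Type) [AddCommGroup M] [Module R M] [Module.Finite R M]
    [AddCommGroup N] [Module R N] [Module.Finite R N] (e : M ≃ₗ[R] N) : mu R M = mu R N := by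
  rw [mu_eq, mu_eq]
  exact LinearEquiv.finrank_eq (e.baseChange R (ResidueField R) M N)

end main

end

end SemiDual

/-- For a semidualizing module C over a Cohen-Macaulay local ring R with canonical
module K, one has mu_R(C) * mu_R(Hom_R(C,K)) = r(R), where the Cohen-Macaulay type
r(R) equals the minimal number of generators of K. -/
theorem mu_mul_mu_dual_eq_type (R : Type) [CommRing R] [IsNoetherianRing R] [IsLocalRing R]
    (hCM : IsCMLocal R)
    (K : Type) [AddCommGroup K] [Module R K] (hK : IsCanonicalModule R K)
    (C : Type) [AddCommGroup C] [Module R C] (hC : IsSemidualizing R C) :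
    mu R C * mu R (C →ₗ[R] K) = mu R K := by
  obtain ⟨⟨hKf, -, -⟩, n, hn⟩ := hK
  obtain ⟨hCf, hb, hCC⟩ := hC
  have hn' : ∀ (M : Type) [AddCommGroup M] [Module R M], ∀ i : ℕ, n < i →
      Subsingleton (SemiDual.E R M K i) := by
    intro M _ _ i hi
    obtain ⟨j, rfl⟩ : ∃ j, i = j + 1 := ⟨i - 1, by omega⟩
    exact SemiDual.bridge j (hn M _ hi)
  have hC' : ∀ i, Subsingleton (SemiDual.E R C C (i + 1)) := fun i =>
    SemiDual.bridge i (hCC _ (by omega))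
  have hnt : Nontrivial C := by
    by_contra hcon
    rw [not_nontrivial_iff_subsingleton] at hcon
    exact one_ne_zero (hb.1 (LinearMap.ext fun c => Subsingleton.elim _ _) : (1 : R) = 0)
  have hK' := SemiDual.claim3 n hn' hC' hb
  have bij := SemiDual.theta_bij n hn' hC' hK'
  rw [← SemiDual.mu_tensor]
  let e1 : R ≃ₗ[R] (C →ₗ[R] C) := LinearEquiv.ofBijective (LinearMap.lsmul R C) hb
  let e2 : ((C →ₗ[R] C) →ₗ[R] K) ≃ₗ[R] (R →ₗ[R] K) := LinearEquiv.congrLeft K R e1.symm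
  exact SemiDual.mu_congr _ _
    (((LinearEquiv.ofBijective _ bij).trans e2).trans (LinearMap.ringLmapEquivSelf R R K))
end

section
/- Let R be a Cohen–Macaulay local ring with canonical module K whose Cohen–Macaulay type r(R) is a prime number. Then every semidualizing R-module C satisfies C ≅ R or C ≅ K. -/
open CategoryTheory IsLocalRing

namespace SDP

/-- Vanishing of `Ext`. -/
abbrev V (R : Type) [CommRing R] (M N : Type) [AddCommGroup M]
    [Module R M] [AddCommGroup N] [Module R N] (i : ℕ) : Prop :=
  Subsingleton (Abelian.Ext (ModuleCat.of R M) (ModuleCat.of R N) i)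

section API
variable {R : Type} [CommRing R]

theorem V_of_ext {M N : Type} [AddCommGroup M]
    [Module R M] [AddCommGroup N] [Module R N] {i : ℕ} (h : Subsingleton (extGroup R M N i)) :
    V R M N i := by
  let P := projectiveResolution (ModuleCat.of R M)
  have hz : Limits.IsZero ((P.complex.linearYonedaObj R (ModuleCat.of R N)).homology i) := by
    refine Limits.IsZero.of_iso ?_ (P.isoExt (R := R) i (ModuleCat.of R N)).symm
    exact ModuleCat.isZero_of_subsingleton _
  rw [← HomologicalComplex.exactAt_iff_isZero_homology] at hz
  refine subsingleton_of_forall_eq 0 fun α => ?_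
  obtain ⟨f, hf, rfl⟩ := P.extMk_surjective α (i + 1) rfl
  cases i with
  | zero =>
    rw [HomologicalComplex.exactAt_iff' _ 0 0 1 (by simp) (by simp)] at hz
    rw [ShortComplex.moduleCat_exact_iff] at hz
    obtain ⟨g, hg⟩ := hz f hf
    have h0 : (HomologicalComplex.sc' (P.complex.linearYonedaObj R (ModuleCat.of R N)) 0 0 1).f = 0 :=
      (P.complex.linearYonedaObj R (ModuleCat.of R N)).shape 0 0
        (by simp : ¬ (ComplexShape.up ℕ).Rel 0 0)
    rw [h0] at hg
    have : f = 0 := hg.symm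
    subst this
    simp
  | succ n =>
    rw [HomologicalComplex.exactAt_iff' _ n (n+1) (n+2) (by simp) (by simp)] at hz
    rw [ShortComplex.moduleCat_exact_iff] at hz
    obtain ⟨g, hg⟩ := hz f hf
    rw [P.extMk_eq_zero_iff _ _ _ _ n rfl]
    exact ⟨g, hg⟩

variable {A B C M : Type} [AddCommGroup A] [Module R A] [AddCommGroup B] [Module R B]
  [AddCommGroup C] [Module R C] [AddCommGroup M] [Module R M]

/-- The short complex attached to an exact pair. -/
abbrev sc (f : A →ₗ[R] B) (g : B →ₗ[R] C) (h : Function.Exact f g) : ShortComplex (ModuleCat.{0} R) :=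
  ShortComplex.mk (ModuleCat.ofHom f) (ModuleCat.ofHom g) (by
    ext x; exact h.apply_apply_eq_zero x)

theorem sc_exact (f : A →ₗ[R] B) (g : B →ₗ[R] C) (h : Function.Exact f g)
    (hf : Function.Injective f) (hg : Function.Surjective g) : (sc f g h).ShortExact where
  exact := by
    rw [ShortComplex.moduleCat_exact_iff]
    intro x hx
    exact (h x).1 hx
  mono_f := (ModuleCat.mono_iff_injective _).2 hf
  epi_g := (ModuleCat.epi_iff_surjective _).2 hg

theorem cov3 {f : A →ₗ[R] B} {g : B →ₗ[R] C} (h : Function.Exact f g)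
    (hf : Function.Injective f) (hg : Function.Surjective g) {i : ℕ}
    (h1 : V R M B i) (h2 : V R M A (i + 1)) : V R M C i := by
  refine subsingleton_of_forall_eq 0 fun α => ?_
  obtain ⟨y, rfl⟩ := Abelian.Ext.covariant_sequence_exact₃ _ (sc_exact f g h hf hg) α rfl
    (Subsingleton.elim (α := Abelian.Ext (ModuleCat.of R M) (ModuleCat.of R A) (i+1)) _ _)
  obtain rfl : y = 0 := Subsingleton.elim
    (α := Abelian.Ext (ModuleCat.of R M) (ModuleCat.of R B) i) _ _
  simp

theorem contra2 {f : A →ₗ[R] B} {g : B →ₗ[R] C} (h : Function.Exact f g)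
    (hf : Function.Injective f) (hg : Function.Surjective g) {i : ℕ}
    (h1 : V R A M i) (h2 : V R C M i) : V R B M i := by
  refine subsingleton_of_forall_eq 0 fun α => ?_
  obtain ⟨y, rfl⟩ := Abelian.Ext.contravariant_sequence_exact₂ (sc_exact f g h hf hg) _ α
    (Subsingleton.elim (α := Abelian.Ext (ModuleCat.of R A) (ModuleCat.of R M) i) _ _)
  obtain rfl : y = 0 := Subsingleton.elim
    (α := Abelian.Ext (ModuleCat.of R C) (ModuleCat.of R M) i) _ _
  simp

theorem contra1 {f : A →ₗ[R] B} {g : B →ₗ[R] C} (h : Function.Exact f g)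
    (hf : Function.Injective f) (hg : Function.Surjective g) {i : ℕ}
    (h1 : V R B M i) (h2 : V R C M (i+1)) : V R A M i := by
  refine subsingleton_of_forall_eq 0 fun α => ?_
  obtain ⟨y, rfl⟩ := Abelian.Ext.contravariant_sequence_exact₁ (sc_exact f g h hf hg) _ α
    (add_comm 1 i)
    (Subsingleton.elim (α := Abelian.Ext (ModuleCat.of R C) (ModuleCat.of R M) (i+1)) _ _)
  obtain rfl : y = 0 := Subsingleton.elim
    (α := Abelian.Ext (ModuleCat.of R B) (ModuleCat.of R M) i) _ _
  simp

theorem contra3 {f : A →ₗ[R] B} {g : B →ₗ[R] C} (h : Function.Exact f g)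
    (hf : Function.Injective f) (hg : Function.Surjective g) {i : ℕ}
    (h1 : V R A M i) (h2 : V R B M (i+1)) : V R C M (i+1) := by
  refine subsingleton_of_forall_eq 0 fun α => ?_
  obtain ⟨y, rfl⟩ := Abelian.Ext.contravariant_sequence_exact₃ (sc_exact f g h hf hg) _ α
    (Subsingleton.elim (α := Abelian.Ext (ModuleCat.of R B) (ModuleCat.of R M) (i+1)) _ _)
    (add_comm 1 i)
  obtain rfl : y = 0 := Subsingleton.elim
    (α := Abelian.Ext (ModuleCat.of R A) (ModuleCat.of R M) i) _ _
  simp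

theorem V_zero_iff : V R M A 0 ↔ Subsingleton (M →ₗ[R] A) :=
  (Abelian.Ext.homEquiv₀.trans ModuleCat.homEquiv).subsingleton_congr

theorem lift_of_V {f : A →ₗ[R] B} {g : B →ₗ[R] C} (h : Function.Exact f g)
    (hf : Function.Injective f) (hg : Function.Surjective g)
    (h1 : V R M A 1) (u : M →ₗ[R] C) : ∃ v : M →ₗ[R] B, g ∘ₗ v = u := by
  obtain ⟨y, hy⟩ := Abelian.Ext.covariant_sequence_exact₃ _ (sc_exact f g h hf hg)
    (Abelian.Ext.mk₀ (ModuleCat.ofHom u)) (zero_add 1)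
    (Subsingleton.elim (α := Abelian.Ext (ModuleCat.of R M) (ModuleCat.of R A) 1) _ _)
  obtain ⟨v, rfl⟩ := (Abelian.Ext.mk₀_bijective _ _).2 y
  rw [Abelian.Ext.mk₀_comp_mk₀] at hy
  have := (Abelian.Ext.mk₀_bijective _ _).1 hy
  exact ⟨v.hom, congrArg ModuleCat.Hom.hom this⟩

/-- Restriction to a submodule (along `f`) is surjective on `Ext^i(-, M)`. -/
def Res (f : A →ₗ[R] B) (M : Type) [AddCommGroup M] [Module R M] (i : ℕ) : Prop :=
  ∀ α : Abelian.Ext (ModuleCat.of R A) (ModuleCat.of R M) i,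
    ∃ β : Abelian.Ext (ModuleCat.of R B) (ModuleCat.of R M) i,
      (Abelian.Ext.mk₀ (ModuleCat.ofHom f)).comp β (zero_add i) = α

theorem res_of_V {f : A →ₗ[R] B} {g : B →ₗ[R] C} (h : Function.Exact f g)
    (hf : Function.Injective f) (hg : Function.Surjective g) {i : ℕ}
    (h2 : V R C M (i+1)) : Res f M i := by
  intro α
  exact Abelian.Ext.contravariant_sequence_exact₁ (sc_exact f g h hf hg) _ α
    (add_comm 1 i)
    (Subsingleton.elim (α := Abelian.Ext (ModuleCat.of R C) (ModuleCat.of R M) (i+1)) _ _)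

theorem res_zero {f : A →ₗ[R] B} (h : Res f M 0) (u : A →ₗ[R] M) :
    ∃ v : B →ₗ[R] M, v ∘ₗ f = u := by
  obtain ⟨β, hβ⟩ := h (Abelian.Ext.mk₀ (ModuleCat.ofHom u))
  obtain ⟨v, rfl⟩ := (Abelian.Ext.mk₀_bijective _ _).2 β
  rw [Abelian.Ext.mk₀_comp_mk₀] at hβ
  have := (Abelian.Ext.mk₀_bijective _ _).1 hβ
  exact ⟨v.hom, congrArg ModuleCat.Hom.hom this⟩

theorem mk0_smul_id (r : R) : Abelian.Ext.mk₀ (ModuleCat.ofHom (LinearMap.lsmul R A r)) =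
    r • Abelian.Ext.mk₀ (𝟙 (ModuleCat.of R A)) := by
  rw [← Abelian.Ext.mk₀_smul]; rfl

theorem ext_smul_zero {r : R} (hr : ∀ m : M, r • m = 0) {i : ℕ}
    (α : Abelian.Ext (ModuleCat.of R M) (ModuleCat.of R A) i) : r • α = 0 := by
  have : r • α = (Abelian.Ext.mk₀ (ModuleCat.ofHom (LinearMap.lsmul R M r))).comp α (zero_add i) := by
    rw [mk0_smul_id]; simp
  rw [this, show (LinearMap.lsmul R M r) = 0 from LinearMap.ext hr]
  have h0 : ModuleCat.ofHom (0 : M →ₗ[R] M) = 0 := rfl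
  rw [h0]; simp

/-- killed by x, multiplication by x on `A` with cokernel `B` -/
theorem cov1_smul {x : R} {g : A →ₗ[R] B} (h : Function.Exact (LinearMap.lsmul R A x) g)
    (hf : Function.Injective (LinearMap.lsmul R A x)) (hg : Function.Surjective g) {i : ℕ}
    (hx : ∀ m : M, x • m = 0) (h1 : V R M B i) : V R M A (i+1) := by
  refine subsingleton_of_forall_eq 0 fun α => ?_
  obtain ⟨y, rfl⟩ := Abelian.Ext.covariant_sequence_exact₁ _ (sc_exact _ g h hf hg) α
    (by
      change α.comp (Abelian.Ext.mk₀ (ModuleCat.ofHom (LinearMap.lsmul R A x))) _ = 0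
      rw [mk0_smul_id]; simp [ext_smul_zero hx]) rfl
  obtain rfl : y = 0 := Subsingleton.elim
    (α := Abelian.Ext (ModuleCat.of R M) (ModuleCat.of R B) i) _ _
  simp

theorem res_step {N : Type} [AddCommGroup N] [Module R N] {j : N →ₗ[R] M}
    {x : R} {g : A →ₗ[R] B} (h : Function.Exact (LinearMap.lsmul R A x) g)
    (hf : Function.Injective (LinearMap.lsmul R A x)) (hg : Function.Surjective g) {i : ℕ}
    (hx : ∀ m : M, x • m = 0) (h1 : V R N A i) (h2 : Res j A (i+1)) : Res j B i := by
  intro α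
  have hS := sc_exact _ g h hf hg
  obtain ⟨β, hβ⟩ := h2 (α.comp hS.extClass rfl)
  obtain ⟨γ, rfl⟩ := Abelian.Ext.covariant_sequence_exact₁ _ hS β
    (by
      change β.comp (Abelian.Ext.mk₀ (ModuleCat.ofHom (LinearMap.lsmul R A x))) _ = 0
      rw [mk0_smul_id]; simp [ext_smul_zero hx]) rfl
  refine ⟨γ, ?_⟩
  rw [← sub_eq_zero]
  obtain ⟨y, hy⟩ := Abelian.Ext.covariant_sequence_exact₃ _ hS
    ((Abelian.Ext.mk₀ (ModuleCat.ofHom j)).comp γ (zero_add i) - α) rfl (by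
      rw [sub_eq_add_neg, Abelian.Ext.add_comp, Abelian.Ext.neg_comp, ← hβ,
        Abelian.Ext.comp_assoc _ _ _ _ _ (by omega), add_neg_cancel]
      rfl)
  obtain rfl : y = 0 := Subsingleton.elim
    (α := Abelian.Ext (ModuleCat.of R N) (ModuleCat.of R A) i) _ _
  rw [← hy]; simp

/-- Nakayama for Ext. -/
theorem nak [IsNoetherianRing R] [IsLocalRing R] [Module.Finite R A] [Module.Finite R M]
    {x : R} (hxm : x ∈ maximalIdeal R)
    {g : A →ₗ[R] B} (h : Function.Exact (LinearMap.lsmul R A x) g)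
    (hf : Function.Injective (LinearMap.lsmul R A x)) (hg : Function.Surjective g) {i : ℕ}
    (h1 : V R B M (i+1)) : V R A M i := by
  have key : ∀ α : Abelian.Ext (ModuleCat.of R A) (ModuleCat.of R M) i, ∃ β, x • β = α := by
    intro α
    obtain ⟨y, hy⟩ := Abelian.Ext.contravariant_sequence_exact₁ (sc_exact _ g h hf hg) _ α
      (add_comm 1 i)
      (Subsingleton.elim (α := Abelian.Ext (ModuleCat.of R B) (ModuleCat.of R M) (i+1)) _ _)
    refine ⟨y, ?_⟩
    rw [← hy]
    change _ = (Abelian.Ext.mk₀ (ModuleCat.ofHom (LinearMap.lsmul R A x))).comp y _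
    rw [mk0_smul_id]; simp
  have fin : Module.Finite R (Abelian.Ext (ModuleCat.of R A) (ModuleCat.of R M) i) := by
    have : Module.Finite R (ModuleCat.of R A) := ‹Module.Finite R A›
    have : Module.Finite R (ModuleCat.of R M) := ‹Module.Finite R M›
    infer_instance
  have : (⊤ : Submodule R (Abelian.Ext (ModuleCat.of R A) (ModuleCat.of R M) i)) = ⊥ := by
    refine Submodule.eq_bot_of_le_smul_of_le_jacobson_bot (maximalIdeal R) _ fin.fg_top ?_ 
      (IsLocalRing.maximalIdeal_le_jacobson _)
    intro α _
    obtain ⟨β, rfl⟩ := key α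
    exact Submodule.smul_mem_smul hxm trivial
  exact (Submodule.subsingleton_iff R).1 (subsingleton_of_bot_eq_top this.symm)

theorem V_congr_left (e : A ≃ₗ[R] B) {i : ℕ} (h : V R A M i) : V R B M i :=
  contra2 (C := PUnit) (f := e.toLinearMap) (g := 0)
    ((e.exact_zero_iff_surjective _).2 e.surjective) e.injective
    (Function.surjective_to_subsingleton _) h (by
      refine subsingleton_of_forall_eq 0 fun α => ?_
      have : α = (1:R) • α := by simp
      rw [this]; exact ext_smul_zero (fun m => rfl) α)

end API
end SDP
namespace SDP
set_option linter.unusedSectionVars false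

/-- `M / J M` -/
abbrev Q {R : Type} [CommRing R] (J : Ideal R) (M : Type) [AddCommGroup M] [Module R M] : Type :=
  M ⧸ (J • (⊤ : Submodule R M))

/-- Ideals generated by regular sequences of length `n` in the maximal ideal. -/
inductive Reg (R : Type) [CommRing R] [IsLocalRing R] : ℕ → Ideal R → Prop
  | zero : Reg R 0 ⊥
  | succ (n : ℕ) (J : Ideal R) (x : R) (h : Reg R n J) (hx : x ∈ maximalIdeal R)
      (hr : ∀ r, x * r ∈ J → r ∈ J) : Reg R (n + 1) (J ⊔ Ideal.span {x})

section
variable {R : Type} [CommRing R]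

section
variable {M : Type} [AddCommGroup M] [Module R M]

/-- projection -/
abbrev qm (J : Ideal R) : M →ₗ[R] Q J M := Submodule.mkQ _

/-- projection -/
abbrev pr (J J' : Ideal R) (h : J ≤ J') : Q J M →ₗ[R] Q J' M :=
  Submodule.factor (Submodule.smul_mono_left h)

theorem mk_surj (J : Ideal R) : Function.Surjective (qm J : M →ₗ[R] Q J M) :=
  Submodule.mkQ_surjective _

theorem pr_mk {J J' : Ideal R} (h : J ≤ J') (m : M) : pr J J' h (qm J m) = qm J' m := rfl

theorem mem_smul_of_Q {J : Ideal R} {r : R} (hr : r ∈ J) (z : Q J M) : r • z = 0 := by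
  obtain ⟨m, rfl⟩ := mk_surj J z
  rw [← map_smul, Submodule.mkQ_apply, Submodule.Quotient.mk_eq_zero]
  exact Submodule.smul_mem_smul hr trivial

theorem pr_surj {J J' : Ideal R} (h : J ≤ J') : Function.Surjective (pr J J' h : Q J M →ₗ[R] Q J' M) := by
  intro z
  obtain ⟨m, rfl⟩ := mk_surj J' z
  exact ⟨qm J m, rfl⟩

theorem pr_exact (J : Ideal R) (x : R) :
    Function.Exact (LinearMap.lsmul R (Q J M) x)
      (pr J (J ⊔ Ideal.span {x}) le_sup_left) := by
  intro z
  obtain ⟨m, rfl⟩ := mk_surj J z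
  constructor
  · intro h
    rw [pr_mk, Submodule.mkQ_apply, Submodule.Quotient.mk_eq_zero, Submodule.sup_smul] at h
    obtain ⟨a, ha, b, hb, rfl⟩ := Submodule.mem_sup.1 h
    rw [Submodule.ideal_span_singleton_smul] at hb
    obtain ⟨c, -, rfl⟩ := Submodule.mem_smul_pointwise_iff_exists _ _ _ |>.1 hb
    refine ⟨qm J c, ?_⟩
    have : qm J a = 0 := (Submodule.Quotient.mk_eq_zero _).2 ha
    rw [map_add, this, zero_add]
    simp
  · rintro ⟨w, hw⟩
    rw [← hw]
    simp only [LinearMap.lsmul_apply, map_smul]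
    exact mem_smul_of_Q (Ideal.mem_sup_right (Ideal.mem_span_singleton_self x)) _

theorem lsmul_inj {x : R} (h : ∀ z : M, x • z = 0 → z = 0) :
    Function.Injective (LinearMap.lsmul R M x) := by
  rw [injective_iff_map_eq_zero]
  exact h

theorem mkR_eq_zero {J : Ideal R} {r : R} : (qm J r : Q J R) = 0 ↔ r ∈ J := by
  rw [Submodule.mkQ_apply, Submodule.Quotient.mk_eq_zero]
  simp

theorem regR {J : Ideal R} {x : R} (hr : ∀ r, x * r ∈ J → r ∈ J) (z : Q J R) (hz : x • z = 0) :
    z = 0 := by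
  obtain ⟨m, rfl⟩ := mk_surj J z
  rw [← map_smul, mkR_eq_zero] at hz
  exact mkR_eq_zero.2 (hr _ hz)

/-- The bottom quotient. -/
noncomputable def botE (M : Type) [AddCommGroup M] [Module R M] : M ≃ₗ[R] Q (⊥ : Ideal R) M :=
  (Submodule.quotEquivOfEqBot _ (by simp)).symm

theorem V_congr_right {A B : Type} [AddCommGroup A] [Module R A] [AddCommGroup B] [Module R B]
    (e : A ≃ₗ[R] B) {i : ℕ} (h : V R M A i) : V R M B i :=
  cov3 (A := PUnit) (f := 0) (g := e.toLinearMap) (by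
      intro y
      constructor
      · intro hy; exact ⟨0, by simpa using (e.map_eq_zero_iff.1 hy).symm⟩
      · rintro ⟨z, rfl⟩; simp) (Function.injective_of_subsingleton _) e.surjective h (by
      refine subsingleton_of_forall_eq 0 fun α => ?_
      rw [← Abelian.Ext.comp_mk₀_id α]
      have : 𝟙 (ModuleCat.of R PUnit) = 0 := by ext
      rw [this]; simp)
end

variable [IsLocalRing R]

theorem Reg.le {n : ℕ} {J : Ideal R} (h : Reg R n J) : J ≤ maximalIdeal R := by
  induction h with
  | zero => exact bot_le
  | succ n J x h hx hr ih => exact sup_le ih ((Ideal.span_singleton_le_iff_mem _).2 hx)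

/-- state of a semidualizing module at level `J` -/
structure SDJ (C : Type) [AddCommGroup C] [Module R C] (J : Ideal R) : Prop where
  van : ∀ i, 0 < i → V R C (Q J C) i
  sur : ∀ f : C →ₗ[R] Q J C, ∃ r : R, ∀ c, f c = r • qm J c
  inj : ∀ r : R, (∀ c : C, r • qm J c = 0) → r ∈ J

variable [IsNoetherianRing R] {C : Type} [AddCommGroup C] [Module R C]

theorem ann_zero (hC : IsSemidualizing R C) {r : R} (h : ∀ c : C, r • c = 0) : r = 0 :=
  hC.2.1.1 (by ext c; simpa using h c)

theorem SDJ.reg {J : Ideal R} (hC : IsSemidualizing R C) (h : SDJ C J) {x : R}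
    (hr : ∀ r, x * r ∈ J → r ∈ J) (z : Q J C) (hz : x • z = 0) : z = 0 := by
  have := hC.1
  let N : Submodule R (Q J C) := LinearMap.ker (LinearMap.lsmul R (Q J C) x)
  have hN : Subsingleton (C →ₗ[R] N) := by
    refine subsingleton_of_forall_eq 0 fun f => ?_
    obtain ⟨r, hf⟩ := h.sur (N.subtype ∘ₗ f)
    have : r ∈ J := by
      apply hr
      apply h.inj
      intro c
      rw [mul_smul, ← hf]
      exact (f c).2
    ext c
    have := hf c
    rw [mem_smul_of_Q ‹r ∈ J›] at this
    exact this
  obtain ⟨r, hr, hreg⟩ := IsSMulRegular.subsingleton_linearMap_iff.1 hN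
  have h0 : r = 0 := ann_zero hC (Module.mem_annihilator.1 hr)
  have : (⟨z, hz⟩ : N) = 0 := hreg (by simp [h0])
  exact congrArg Subtype.val this

theorem SDJ.of {n : ℕ} {J : Ideal R} (hJ : Reg R n J) (hC : IsSemidualizing R C) : SDJ C J := by
  induction hJ with
  | zero =>
    refine ⟨fun i hi => V_congr_right (botE C) (V_of_ext (hC.2.2 i hi)), fun f => ?_, fun r hr => ?_⟩
    · obtain ⟨r, hr⟩ := hC.2.1.2 ((botE (R := R) C).symm.toLinearMap ∘ₗ f)
      refine ⟨r, fun c => ?_⟩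
      have := LinearMap.congr_fun hr c
      rw [LinearMap.comp_apply] at this
      have h2 := congrArg (botE (R := R) C) this
      simp only [LinearEquiv.coe_coe, LinearEquiv.apply_symm_apply] at h2
      rw [← h2]
      simp [botE]
    · refine ann_zero hC fun c => ?_
      have := hr c
      rw [← map_smul, Submodule.mkQ_apply, Submodule.Quotient.mk_eq_zero] at this
      simpa using this
  | succ n J x h hx hr ih =>
    have hreg := ih.reg hC hr
    have hi := lsmul_inj hreg
    refine ⟨fun i hi0 => cov3 (pr_exact J x) hi (pr_surj _) (ih.van i hi0) (ih.van (i+1) (by omega)),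
      fun f => ?_, fun r hr0 => ?_⟩
    · obtain ⟨v, rfl⟩ := lift_of_V (pr_exact J x) hi (pr_surj _) (ih.van 1 one_pos) f
      obtain ⟨r, hr⟩ := ih.sur v
      refine ⟨r, fun c => ?_⟩
      rw [LinearMap.comp_apply, hr, map_smul]; rfl
    · have : ∀ c : C, ∃ w : Q J C, x • w = r • qm J c := by
        intro c
        exact (pr_exact J x _).1 (by rw [map_smul]; exact hr0 c)
      choose w hw using this
      let g : C →ₗ[R] Q J C :=
        { toFun := w
          map_add' := fun a b => hi (by simp [hw])
          map_smul' := fun a b => hi (by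
            simp only [LinearMap.lsmul_apply, RingHom.id_apply]
            rw [hw, smul_comm x a, hw, map_smul, smul_comm]) }
      obtain ⟨s, hs⟩ := ih.sur g
      have hmem : r - x * s ∈ J := by
        apply ih.inj
        intro c
        rw [sub_smul, ← hw, mul_smul, ← hs]
        exact sub_self _
      have := Ideal.add_mem _ (Ideal.mem_sup_left (T := Ideal.span {x}) hmem)
        (Ideal.mem_sup_right (S := J) (Ideal.mul_mem_right s _ (Ideal.mem_span_singleton_self x)))
      simpa using this

/-- existence of maximal regular sequences -/
theorem exists_reg {n : ℕ} {J : Ideal R} (hJ : Reg R n J) (t : ℕ)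
    (h : ∀ i < t, V R (ResidueField R) (Q J R) i) : ∃ J', Reg R (n + t) J' := by
  induction t generalizing n J with
  | zero => exact ⟨J, hJ⟩
  | succ t ih =>
    have h0 := V_zero_iff.1 (h 0 (by omega))
    obtain ⟨x, hx, hreg⟩ := IsSMulRegular.subsingleton_linearMap_iff.1 h0
    have hx' : x ∈ maximalIdeal R := by
      have := Module.mem_annihilator.1 hx 1
      rw [Algebra.smul_def, mul_one] at this
      exact (IsLocalRing.residue_eq_zero_iff x).1 this
    have hr : ∀ r, x * r ∈ J → r ∈ J := by
      intro r hr
      rw [← mkR_eq_zero]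
      apply hreg
      change x • _ = x • _
      rw [← map_smul, smul_zero]
      exact mkR_eq_zero.2 hr
    obtain ⟨J', hJ'⟩ := ih (Reg.succ n J x hJ hx' hr) (fun i hi =>
      cov3 (pr_exact J x) (lsmul_inj (regR hr)) (pr_surj _) (h i (by omega)) (h (i+1) (by omega)))
    exact ⟨J', by convert hJ' using 1; omega⟩

theorem Reg.dim {n : ℕ} {J : Ideal R} (hJ : Reg R n J) :
    ringKrullDim (R ⧸ J) + n ≤ ringKrullDim R := by
  induction hJ with
  | zero =>
    rw [ringKrullDim_eq_of_ringEquiv (RingEquiv.quotientBot R)]; simp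
  | succ n J x h hx hr ih =>
    have hnz : Ideal.Quotient.mk J x ∈ nonZeroDivisors (R ⧸ J) := by
      rw [mem_nonZeroDivisors_iff_right]
      intro z hz
      obtain ⟨r, rfl⟩ := Ideal.Quotient.mk_surjective z
      rw [← map_mul, Ideal.Quotient.eq_zero_iff_mem, mul_comm] at hz
      exact Ideal.Quotient.eq_zero_iff_mem.2 (hr _ hz)
    have h1 := ringKrullDim_quotient_succ_le_of_nonZeroDivisor hnz
    have e := DoubleQuot.quotQuotEquivQuotSup J (Ideal.span {x})
    rw [Ideal.map_span, Set.image_singleton] at e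
    rw [ringKrullDim_eq_of_ringEquiv e] at h1
    calc _ = ringKrullDim (R ⧸ J ⊔ Ideal.span {x}) + 1 + n := by push_cast; rw [add_assoc, add_comm 1]
      _ ≤ ringKrullDim (R ⧸ J) + n := by gcongr
      _ ≤ _ := ih

theorem exists_J (hCM : IsCMLocal R) : ∃ (d : ℕ) (J : Ideal R), Reg R d J ∧
    ∀ p : Ideal R, p.IsPrime → J ≤ p → p = maximalIdeal R := by
  obtain ⟨J, hJ⟩ := exists_reg Reg.zero (ringDepth R) (R := R) (fun i hi => by
    have := Nat.notMem_of_lt_sInf hi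
    exact V_congr_right (botE R) (V_of_ext (not_not.1 this)))
  rw [zero_add] at hJ
  refine ⟨_, J, hJ, fun p hp hJp => ?_⟩
  have h1 := hJ.dim
  rw [hCM] at h1
  have h2 : ringKrullDim (R ⧸ J) ≤ 0 := by
    have : ringKrullDim (R ⧸ J) + (ringDepth R : WithBot ℕ∞) ≤ 0 + (ringDepth R : WithBot ℕ∞) := by
      rw [zero_add]; exact h1
    exact ENat.WithBot.add_le_add_natCast_right_iff.1 this
  have : Ring.KrullDimLE 0 (R ⧸ J) := by
    exact (Ring.krullDimLE_iff).2 h2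
  have hpm : (p.map (Ideal.Quotient.mk J)).IsPrime :=
    Ideal.map_isPrime_of_surjective Ideal.Quotient.mk_surjective (by simpa using hJp)
  have hmax := Ideal.IsPrime.isMaximal' (I := p.map (Ideal.Quotient.mk J))
  have := Ideal.comap_isMaximal_of_surjective (Ideal.Quotient.mk J) Ideal.Quotient.mk_surjective
    (K := p.map (Ideal.Quotient.mk J))
  rw [Ideal.comap_map_of_surjective _ Ideal.Quotient.mk_surjective] at this
  rw [← RingHom.ker_eq_comap_bot, Ideal.mk_ker, sup_eq_left.2 hJp] at this
  exact IsLocalRing.eq_maximalIdeal this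

end
end SDP
namespace SDP
set_option linter.unusedSectionVars false
section
variable {R : Type} [CommRing R] [IsLocalRing R] [IsNoetherianRing R]

theorem exists_socle {J : Ideal R} (hmax : ∀ p : Ideal R, p.IsPrime → J ≤ p → p = maximalIdeal R)
    (M : Type) [AddCommGroup M] [Module R M] [Nontrivial M]
    (hM : ∀ r ∈ J, ∀ m : M, r • m = 0) : ∃ z : M, z ≠ 0 ∧ ∀ r ∈ maximalIdeal R, r • z = 0 := by
  obtain ⟨p, hp⟩ := associatedPrimes.nonempty R M
  obtain ⟨hp, z, hz⟩ := (isAssociatedPrime_iff).1 hp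
  have hmem : ∀ r, r ∈ p ↔ r • z = 0 := by
    intro r; rw [hz, Submodule.mem_colon_singleton]; simp
  have : p = maximalIdeal R := hmax p hp fun r hr => (hmem r).2 (hM r hr z)
  refine ⟨z, ?_, fun r hr => (hmem r).1 (this ▸ hr)⟩
  rintro rfl
  exact hp.ne_top ((Ideal.eq_top_iff_one _).2 ((hmem 1).2 (by simp)))

/-- the map from the residue field determined by a socle element -/
theorem exists_kmap {M : Type} [AddCommGroup M] [Module R M] {z : M} (hz0 : z ≠ 0)
    (hz : ∀ r ∈ maximalIdeal R, r • z = 0) :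
    ∃ f : (R ⧸ maximalIdeal R) →ₗ[R] M, Function.Injective f ∧ ∀ r : R,
      f (Submodule.Quotient.mk r) = r • z := by
  refine ⟨Submodule.liftQ _ (LinearMap.toSpanSingleton R M z) (fun r hr => by simpa using hz r hr),
    ?_, fun r => rfl⟩
  rw [injective_iff_map_eq_zero]
  intro a ha
  obtain ⟨r, rfl⟩ := Submodule.Quotient.mk_surjective _ a
  rw [Submodule.Quotient.mk_eq_zero]
  by_contra hr
  have hu : IsUnit r := by simpa using hr
  simp only [Submodule.liftQ_apply, LinearMap.toSpanSingleton_apply] at ha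
  exact hz0 ((hu.smul_eq_zero).1 ha)

variable {K : Type} [AddCommGroup K] [Module R K]

theorem pd {n : ℕ} {J : Ideal R} (hJ : Reg R n J) : ∀ i, n < i → V R (Q J R) K i := by
  induction hJ with
  | zero =>
    intro i hi
    obtain ⟨i, rfl⟩ := Nat.exists_eq_succ_of_ne_zero hi.ne'
    refine V_congr_left (botE (R := R) R) ?_
    have : Projective (ModuleCat.of R R) := inferInstance
    exact Abelian.Ext.subsingleton_of_projective _ _ _
  | succ n J x h hx hr ih =>
    intro i hi
    obtain ⟨i, rfl⟩ := Nat.exists_eq_succ_of_ne_zero (by omega : i ≠ 0)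
    exact contra3 (pr_exact J x) (lsmul_inj (regR hr)) (pr_surj _) (ih i (by omega))
      (ih (i+1) (by omega))

theorem devissage {J : Ideal R} (hmax : ∀ p : Ideal R, p.IsPrime → J ≤ p → p = maximalIdeal R)
    {i : ℕ} (h : V R (R ⧸ maximalIdeal R) K i) (M : Type) [AddCommGroup M] [Module R M]
    [hM : Module.Finite R M] (hMJ : ∀ r ∈ J, ∀ m : M, r • m = 0) : V R M K i := by
  revert hMJ
  refine IsNoetherianRing.induction_on_isQuotientEquivQuotientPrime R hM
    (motive := fun N _ _ _ => (∀ r ∈ J, ∀ m : N, r • m = 0) → V R N K i) ?_ ?_ ?_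
  · intro N _ _ _ _ _
    refine subsingleton_of_forall_eq 0 fun α => ?_
    have : α = (1:R) • α := by simp
    rw [this]; exact ext_smul_zero (fun m => Subsingleton.elim _ _) α
  · intro N _ _ _ p e hN
    have : p.1 = maximalIdeal R := by
      refine hmax _ p.2 fun r hr => ?_
      have := hN r hr (e.symm (Ideal.Quotient.mk _ 1))
      rw [← map_smul, LinearEquiv.map_eq_zero_iff, Algebra.smul_def, map_one, mul_one] at this
      exact Ideal.Quotient.eq_zero_iff_mem.1 this
    rw [this] at e
    exact V_congr_left e.symm h
  · intro N₁ _ _ _ N₂ _ _ _ N₃ _ _ _ f g hf hg hfg h1 h3 h2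
    refine contra2 hfg hf hg (h1 fun r hr m => ?_) (h3 fun r hr m => ?_)
    · exact hf (by rw [map_smul, h2 r hr, map_zero])
    · obtain ⟨m, rfl⟩ := hg m
      rw [← map_smul, h2 r hr, map_zero]

theorem van_high {d : ℕ} {J : Ideal R} (hJ : Reg R d J)
    (hmax : ∀ p : Ideal R, p.IsPrime → J ≤ p → p = maximalIdeal R)
    (hK : HasFiniteInjDim R K) : ∀ i, d < i → ∀ (M : Type) [AddCommGroup M] [Module R M]
    [Module.Finite R M], (∀ r ∈ J, ∀ m : M, r • m = 0) → V R M K i := by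
  obtain ⟨n, hn⟩ := hK
  have hd := hJ.le
  have key : ∀ t : ℕ, ∀ i, d < i → n < i + t → ∀ (M : Type) [AddCommGroup M] [Module R M]
    [Module.Finite R M], (∀ r ∈ J, ∀ m : M, r • m = 0) → V R M K i := by
    intro t
    induction t with
    | zero => intro i _ hi M _ _ _ _; exact V_of_ext (hn M i hi)
    | succ t ih =>
      intro i hdi hi M _ _ _ hMJ
      refine devissage hmax ?_ M hMJ
      have hkill : ∀ r ∈ J, ∀ m : Q J R, r • m = 0 := fun r hr m => mem_smul_of_Q hr m
      have : Nontrivial (Q J R) := by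
        refine ⟨⟨qm J 1, 0, fun h => ?_⟩⟩
        have := hd (mkR_eq_zero.1 h)
        exact (Ideal.ne_top_iff_one _).1 (maximalIdeal.isMaximal R).ne_top this
      obtain ⟨z, hz0, hz⟩ := exists_socle hmax (Q J R) hkill
      obtain ⟨f, hf, -⟩ := exists_kmap hz0 hz
      refine contra1 (C := Q J R ⧸ LinearMap.range f) (f := f) (g := Submodule.mkQ _)
        (LinearMap.exact_map_mkQ_range f) hf (Submodule.mkQ_surjective _) (pd hJ i hdi)
        (ih (i+1) (by omega) (by omega) _ ?_)
      intro r hr m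
      obtain ⟨m, rfl⟩ := Submodule.mkQ_surjective _ m
      rw [← map_smul, hkill r hr, map_zero]
  intro i hi
  exact key n i hi (by omega)

variable {C : Type} [AddCommGroup C] [Module R C]

theorem van_CK_aux {n : ℕ} {J : Ideal R} (hJ : Reg R n J) (hC : IsSemidualizing R C)
    [Module.Finite R K] : (∀ i, n < i → V R (Q J C) K i) → ∀ i, 0 < i → V R C K i := by
  have := hC.1
  induction hJ with
  | zero => intro h i hi; exact V_congr_left (botE (R := R) C).symm (h i hi)
  | succ n J x h hx hr ih =>
    intro h'
    apply ih
    intro i hi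
    exact nak hx (pr_exact J x) (lsmul_inj ((SDJ.of h hC).reg hC hr)) (pr_surj _) (h' (i+1) (by omega))

theorem van_CK {d : ℕ} {J : Ideal R} (hJ : Reg R d J)
    (hmax : ∀ p : Ideal R, p.IsPrime → J ≤ p → p = maximalIdeal R)
    (hK : IsCanonicalModule R K) (hC : IsSemidualizing R C) : ∀ i, 0 < i → V R C K i := by
  have := hC.1
  have := hK.1.1
  exact van_CK_aux hJ hC fun i hi => van_high hJ hmax hK.2 i hi _ fun r hr m => mem_smul_of_Q hr m

theorem van_CKJ {n : ℕ} {J : Ideal R} (hJ : Reg R n J) (hK : IsSemidualizing R K)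
    (h : ∀ i, 0 < i → V R C K i) : ∀ i, 0 < i → V R C (Q J K) i := by
  induction hJ with
  | zero => intro i hi; exact V_congr_right (botE (R := R) K) (h i hi)
  | succ n J x h hx hr ih =>
    intro i hi
    exact cov3 (pr_exact J x) (lsmul_inj ((SDJ.of h hK).reg hK hr)) (pr_surj _) (ih i hi)
      (ih (i+1) (by omega))

/-- Lifting homs. -/
theorem lift_hom {n : ℕ} {J : Ideal R} (hJ : Reg R n J) (hK : IsSemidualizing R K)
    (h : ∀ i, 0 < i → V R C K i) (u : C →ₗ[R] Q J K) : ∃ v : C →ₗ[R] K, qm J ∘ₗ v = u := by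
  induction hJ with
  | zero =>
    refine ⟨(botE (R := R) K).symm.toLinearMap ∘ₗ u, ?_⟩
    ext c
    obtain ⟨k, hk⟩ := (botE (R := R) K).surjective (u c)
    simp only [LinearMap.comp_apply, ← hk, LinearEquiv.coe_coe, LinearEquiv.symm_apply_apply]
    simp [botE]
  | succ n J x hJ hx hr ih =>
    obtain ⟨w, rfl⟩ := lift_of_V (pr_exact J x) (lsmul_inj ((SDJ.of hJ hK).reg hK hr)) (pr_surj _)
      (van_CKJ hJ hK h 1 one_pos) u
    obtain ⟨v, rfl⟩ := ih w
    exact ⟨v, rfl⟩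

theorem inj_of_inj {n : ℕ} {J : Ideal R} (hJ : Reg R n J) (hK : IsSemidualizing R K)
    [Module.Finite R C] (v : C →ₗ[R] K)
    (hv : ∀ c : C, qm J (v c) = 0 → qm J c = 0) : Function.Injective v := by
  induction hJ with
  | zero =>
    rw [injective_iff_map_eq_zero]
    intro c hc
    have := hv c (by rw [hc, map_zero])
    rw [Submodule.mkQ_apply, Submodule.Quotient.mk_eq_zero] at this
    simpa using this
  | succ n J x hJ hx hr ih =>
    apply ih
    have hreg := (SDJ.of hJ hK).reg hK hr
    have hker : ∀ c : C, qm J (v c) = 0 → ∃ c' : C, qm J (v c') = 0 ∧ qm J c = x • qm J c' := by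
      intro c hc
      have h1 : qm (J ⊔ Ideal.span {x}) c = 0 := by
        apply hv
        rw [← pr_mk (le_sup_left : J ≤ _), hc, map_zero]
      obtain ⟨w, hw⟩ := (pr_exact J x (qm J c)).1 h1
      obtain ⟨c', rfl⟩ := mk_surj J w
      refine ⟨c', hreg _ ?_, hw.symm⟩
      have h2 : qm J (c - x • c') = 0 := by
        rw [map_sub, map_smul, ← hw]; simp
      rw [Submodule.mkQ_apply, Submodule.Quotient.mk_eq_zero] at h2
      have h3 : qm J (v (c - x • c')) = 0 := by
        rw [Submodule.mkQ_apply, Submodule.Quotient.mk_eq_zero]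
        have := Submodule.mem_map_of_mem (f := v) h2
        rw [Submodule.map_smul''] at this
        exact Submodule.smul_mono le_rfl le_top this
      rw [map_sub, map_sub, hc, zero_sub, neg_eq_zero, map_smul, map_smul] at h3
      exact h3
    let L : Submodule R (Q J C) := (LinearMap.ker (qm J ∘ₗ v)).map (qm J)
    have hL : L = ⊥ := by
      refine Submodule.eq_bot_of_le_smul_of_le_jacobson_bot (maximalIdeal R) _
        (IsNoetherian.noetherian _) ?_ (IsLocalRing.maximalIdeal_le_jacobson _)
      rintro _ ⟨c, hc, rfl⟩
      obtain ⟨c', h1, h2⟩ := hker c hc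
      rw [h2]
      exact Submodule.smul_mem_smul hx ⟨c', h1, rfl⟩
    intro c hc
    have : qm J c ∈ L := ⟨c, hc, rfl⟩
    rw [hL] at this
    exact this

section
variable {M N : Type} [AddCommGroup M] [Module R M] [AddCommGroup N] [Module R N]

theorem vlow {n : ℕ} {J : Ideal R} (hJ : Reg R n J) (hK : IsSemidualizing R K)
    (hN : ∀ r ∈ J, ∀ m : N, r • m = 0) (j : ℕ) (h : ∀ i < j, V R N (Q J K) i) :
    ∀ i < n + j, V R N K i := by
  induction hJ generalizing j with
  | zero => intro i hi; exact V_congr_right (botE (R := R) K).symm (h i (by omega))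
  | succ n J x hJ hx hr ih =>
    have hreg := (SDJ.of hJ hK).reg hK hr
    have hxN := hN x (Ideal.mem_sup_right (Ideal.mem_span_singleton_self x))
    intro i hi
    refine ih (fun r hr => hN r (Ideal.mem_sup_left hr)) (j + 1) ?_ i (by omega)
    intro i hi
    cases i with
    | zero =>
      rw [V_zero_iff]
      refine subsingleton_of_forall_eq 0 fun f => LinearMap.ext fun m => ?_
      apply hreg
      rw [← map_smul, hxN, map_zero]
    | succ i =>
      exact cov1_smul (pr_exact J x) (lsmul_inj hreg) (pr_surj _) hxN (h i (by omega))

theorem res_congr {A : Type} [AddCommGroup A] [Module R A] (e : K ≃ₗ[R] A) {f : N →ₗ[R] M} {i : ℕ}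
    (h : Res f K i) : Res f A i := by
  intro α
  obtain ⟨β, hβ⟩ := h (α.comp (Abelian.Ext.mk₀ (ModuleCat.ofHom e.symm.toLinearMap)) (add_zero i))
  refine ⟨β.comp (Abelian.Ext.mk₀ (ModuleCat.ofHom e.toLinearMap)) (add_zero i), ?_⟩
  rw [← Abelian.Ext.comp_assoc_of_third_deg_zero, hβ, Abelian.Ext.comp_assoc_of_third_deg_zero,
    Abelian.Ext.mk₀_comp_mk₀]
  have : ModuleCat.ofHom e.symm.toLinearMap ≫ ModuleCat.ofHom e.toLinearMap = 𝟙 _ := by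
    ext x; simp
  rw [this]; simp

theorem rlow {n : ℕ} {J : Ideal R} (hJ : Reg R n J) (hK : IsSemidualizing R K) {f : N →ₗ[R] M}
    (hM : ∀ r ∈ J, ∀ m : M, r • m = 0) (j : ℕ) (h : ∀ i < n + j, V R N K i)
    (h2 : Res f K (n + j)) : (∀ i < j, V R N (Q J K) i) ∧ Res f (Q J K) j := by
  induction hJ generalizing j with
  | zero =>
    refine ⟨fun i hi => V_congr_right (botE (R := R) K) (h i (by omega)), ?_⟩
    rw [zero_add] at h2
    exact res_congr (botE (R := R) K) h2
  | succ n J x hJ hx hr ih =>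
    have hreg := (SDJ.of hJ hK).reg hK hr
    have hxM := hM x (Ideal.mem_sup_right (Ideal.mem_span_singleton_self x))
    obtain ⟨h3, h4⟩ := ih (fun r hr => hM r (Ideal.mem_sup_left hr)) (j + 1)
      (fun i hi => h i (by omega)) (by rwa [show n + (j + 1) = n + 1 + j by omega])
    exact ⟨fun i hi => cov3 (pr_exact J x) (lsmul_inj hreg) (pr_surj _) (h3 i (by omega))
      (h3 (i+1) (by omega)), res_step (pr_exact J x) (lsmul_inj hreg) (pr_surj _) hxM
      (h3 j (by omega)) h4⟩

theorem inj_ext {d : ℕ} {J : Ideal R} (hJ : Reg R d J)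
    (hmax : ∀ p : Ideal R, p.IsPrime → J ≤ p → p = maximalIdeal R)
    (hK : IsCanonicalModule R K) [Module.Finite R M] (hM : ∀ r ∈ J, ∀ m : M, r • m = 0)
    (f : N →ₗ[R] M) (hf : Function.Injective f) (u : N →ₗ[R] Q J K) :
    ∃ v : M →ₗ[R] Q J K, ∀ a, v (f a) = u a := by
  have hN : ∀ r ∈ J, ∀ m : N, r • m = 0 := fun r hr m => hf (by rw [map_smul, hM r hr, map_zero])
  have h1 : Res f K d := res_of_V (C := M ⧸ LinearMap.range f) (g := Submodule.mkQ _)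
    (LinearMap.exact_map_mkQ_range f) hf (Submodule.mkQ_surjective _)
    (van_high hJ hmax hK.2 (d+1) (by omega) _ (fun r hr m => by
      obtain ⟨m, rfl⟩ := Submodule.mkQ_surjective _ m
      rw [← map_smul, hM r hr, map_zero]))
  have h2 := vlow (K := K) hJ hK.1 hN 0 (by simp)
  obtain ⟨v, rfl⟩ := res_zero (rlow hJ hK.1 hM 0 h2 h1).2 u
  exact ⟨v, fun a => rfl⟩

end
end
end SDP
namespace SDP
set_option linter.unusedSectionVars false
section
variable {R : Type} [CommRing R] [IsLocalRing R] [IsNoetherianRing R]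

theorem kfree (M : Type) [AddCommGroup M] [Module (R ⧸ maximalIdeal R) M] :
    Module.Free (R ⧸ maximalIdeal R) M := by
  letI : Field (R ⧸ maximalIdeal R) := Ideal.Quotient.field _
  exact Module.Free.of_divisionRing _ _

theorem ksurj : Function.Surjective (algebraMap R (R ⧸ maximalIdeal R)) :=
  Ideal.Quotient.mk_surjective

theorem mu_eq (M : Type) [AddCommGroup M] [Module R M] [hM : Module.Finite R M] :
    mu R M = Module.finrank (R ⧸ maximalIdeal R) (Q (maximalIdeal R) M) := by
  have hfg : (⊤ : Submodule R M).FG := hM.1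
  have h1 : mu R M = (⊤ : Submodule R M).spanFinrank := by
    apply le_antisymm
    · refine Nat.sInf_le ⟨hfg.finite_generators.toFinset, ?_, ?_⟩
      · rw [← Set.ncard_eq_toFinset_card _ hfg.finite_generators, Submodule.FG.generators_ncard hfg]
      · rw [Set.Finite.coe_toFinset, Submodule.span_generators]
    · have hne : {n : ℕ | ∃ s : Finset M, s.card = n ∧ Submodule.span R (s : Set M) = ⊤}.Nonempty := by
        obtain ⟨s, hs⟩ := hfg
        exact ⟨_, s, rfl, hs⟩
      obtain ⟨s, hs, hs'⟩ := Nat.sInf_mem hne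
      rw [mu, ← hs, ← hs', ← Set.ncard_coe_finset]
      exact Submodule.spanFinrank_span_le_ncard_of_finite s.finite_toSet
  rw [h1, IsLocalRing.spanFinrank_eq_finrank_quotient _ hfg]
  refine LinearEquiv.finrank_eq (LinearEquiv.extendScalarsOfSurjective ksurj
    (Submodule.Quotient.equiv _ _ Submodule.topEquiv ?_))
  rw [Submodule.map_smul'']
  congr 1
  simp

abbrev S (R M : Type) [CommRing R] [IsLocalRing R] [AddCommGroup M] [Module R M] : Submodule R M :=
  Submodule.torsionBySet R M (maximalIdeal R : Set R)

theorem mem_S {M : Type} [AddCommGroup M] [Module R M] {z : M} :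
    z ∈ S R M ↔ ∀ r ∈ maximalIdeal R, r • z = 0 := by
  simp [S, Submodule.mem_torsionBySet_iff]

theorem kfin (M : Type) [AddCommGroup M] [Module R M] [Module (R ⧸ maximalIdeal R) M]
    [IsScalarTower R (R ⧸ maximalIdeal R) M] [Module.Finite R M] :
    Module.Finite (R ⧸ maximalIdeal R) M := Module.Finite.of_restrictScalars_finite R _ _

variable {C : Type} [AddCommGroup C] [Module R C]

theorem count {n : ℕ} {J : Ideal R} (hJ : Reg R n J) (hC : IsSemidualizing R C) :
    Module.finrank (R ⧸ maximalIdeal R) (S R (Q J R)) =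
    Module.finrank (R ⧸ maximalIdeal R) (Q (maximalIdeal R) C) *
      Module.finrank (R ⧸ maximalIdeal R) (S R (Q J C)) := by
  have := hC.1
  have hD := SDJ.of hJ hC
  let a0 : Q J R →ₗ[R] (C →ₗ[R] Q J C) := Submodule.liftQ _
    (LinearMap.toSpanSingleton R (C →ₗ[R] Q J C) (qm J)) (by
      intro r hr
      have hr : r ∈ J := by simpa using hr
      rw [LinearMap.mem_ker, LinearMap.toSpanSingleton_apply]
      ext c
      exact mem_smul_of_Q hr _)
  have ha0 : ∀ r c, a0 (qm J r) c = r • qm J c := fun r c => rfl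
  have ha0i : Function.Injective a0 := by
    rw [injective_iff_map_eq_zero]
    intro z hz
    obtain ⟨r, rfl⟩ := mk_surj J z
    refine mkR_eq_zero.2 (hD.inj r fun c => ?_)
    rw [← ha0, hz]; rfl
  let a : S R (Q J R) →ₗ[R] (C →ₗ[R] Q J C) := a0 ∘ₗ (S R (Q J R)).subtype
  have hai : Function.Injective a := ha0i.comp Subtype.val_injective
  let b : (Q (maximalIdeal R) C →ₗ[R] S R (Q J C)) →ₗ[R] (C →ₗ[R] Q J C) :=
    { toFun := fun F => (S R (Q J C)).subtype ∘ₗ F ∘ₗ qm _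
      map_add' := fun F G => rfl
      map_smul' := fun r F => rfl }
  have hbi : Function.Injective b := by
    intro F G h
    ext c
    exact congrArg (fun f => f c) h
  have hrange : LinearMap.range a = LinearMap.range b := by
    ext f
    have h1 : f ∈ LinearMap.range a ↔ ∀ r ∈ maximalIdeal R, r • f = 0 := by
      constructor
      · rintro ⟨z, rfl⟩ r hr
        rw [← map_smul]
        have : r • z = 0 := Subtype.ext (mem_S.1 z.2 r hr)
        rw [this, map_zero]
      · intro h
        obtain ⟨s, hs⟩ := hD.sur f
        have hf : a0 (qm J s) = f := by ext c; rw [ha0, hs]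
        refine ⟨⟨qm J s, mem_S.2 fun r hr => ha0i ?_⟩, hf⟩
        rw [map_smul, hf, h r hr, map_zero]
    have h2 : f ∈ LinearMap.range b ↔ ∀ r ∈ maximalIdeal R, r • f = 0 := by
      constructor
      · rintro ⟨F, rfl⟩ r hr
        ext c
        exact mem_S.1 (F (qm _ c)).2 r hr
      · intro h
        have hk : ∀ c, f c ∈ S R (Q J C) := fun c => mem_S.2 fun r hr => by
          rw [← LinearMap.smul_apply, h r hr]; rfl
        refine ⟨Submodule.liftQ _ (f.codRestrict _ hk) ?_, ?_⟩
        · rw [Submodule.smul_le]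
          intro r hr c _
          rw [LinearMap.mem_ker, map_smul]
          exact Subtype.ext (mem_S.1 (hk c) r hr)
        · ext c; rfl
    rw [h1, h2]
  let e : S R (Q J R) ≃ₗ[R] (Q (maximalIdeal R) C →ₗ[R] S R (Q J C)) :=
    (LinearEquiv.ofInjective a hai).trans ((LinearEquiv.ofEq _ _ hrange).trans
      (LinearEquiv.ofInjective b hbi).symm)
  let e' : S R (Q J R) ≃ₗ[R]
      (Q (maximalIdeal R) C →ₗ[R ⧸ maximalIdeal R] S R (Q J C)) :=
    e.trans (LinearMap.extendScalarsOfSurjectiveEquiv ksurj)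
  rw [LinearEquiv.finrank_eq (LinearEquiv.extendScalarsOfSurjective ksurj e')]
  have := kfree (R := R) (Q (maximalIdeal R) C)
  have := kfree (R := R) (S R (Q J C))
  have := kfin (R := R) (Q (maximalIdeal R) C)
  have := kfin (R := R) (S R (Q J C))
  exact Module.finrank_linearMap _ _ _ _

theorem QC_nontrivial {n : ℕ} {J : Ideal R} (hJ : Reg R n J) (hC : IsSemidualizing R C) :
    Nontrivial (Q J C) := by
  by_contra h
  rw [not_nontrivial_iff_subsingleton] at h
  have := hJ.le ((SDJ.of hJ hC).inj 1 fun c => Subsingleton.elim _ _)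
  exact (Ideal.ne_top_iff_one _).1 (maximalIdeal.isMaximal R).ne_top this

variable {K : Type} [AddCommGroup K] [Module R K]

theorem tK {n : ℕ} {J : Ideal R} (hJ : Reg R n J)
    (hmax : ∀ p : Ideal R, p.IsPrime → J ≤ p → p = maximalIdeal R) (hK : IsCanonicalModule R K) :
    Module.finrank (R ⧸ maximalIdeal R) (S R (Q J K)) = 1 := by
  have := hK.1.1
  have := QC_nontrivial hJ hK.1
  have hkill : ∀ r ∈ J, ∀ m : Q J K, r • m = 0 := fun r hr m => mem_smul_of_Q hr m
  obtain ⟨v, hv0, hv⟩ := exists_socle hmax (Q J K) hkill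
  letI : Field (R ⧸ maximalIdeal R) := Ideal.Quotient.field _
  refine finrank_eq_one (⟨v, mem_S.2 hv⟩ : S R (Q J K)) (fun h => hv0 (congrArg Subtype.val h)) ?_
  rintro ⟨w, hw⟩
  by_cases hw0 : w = 0
  · exact ⟨0, by rw [zero_smul]; exact Subtype.ext hw0.symm⟩
  obtain ⟨f, hf, hf'⟩ := exists_kmap hv0 hv
  obtain ⟨g, hg, hg'⟩ := exists_kmap hw0 (mem_S.1 hw)
  obtain ⟨φ, hφ⟩ := inj_ext hJ hmax hK hkill f hf g
  have h1 : φ v = w := by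
    have := hφ (Submodule.Quotient.mk 1)
    rwa [hf', hg', one_smul, one_smul] at this
  obtain ⟨r, hr⟩ := (SDJ.of hJ hK.1).sur (φ ∘ₗ qm J)
  obtain ⟨k, rfl⟩ := mk_surj J v
  refine ⟨Ideal.Quotient.mk _ r, Subtype.ext ?_⟩
  exact (hr k).symm.trans h1

theorem iso_R (hC : IsSemidualizing R C) (h : mu R C = 1) : Nonempty (C ≃ₗ[R] R) := by
  have := hC.1
  have hne : {n : ℕ | ∃ s : Finset C, s.card = n ∧ Submodule.span R (s : Set C) = ⊤}.Nonempty := by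
    obtain ⟨s, hs⟩ := hC.1.1
    exact ⟨_, s, rfl, hs⟩
  obtain ⟨s, hs, hs'⟩ := Nat.sInf_mem hne
  rw [show sInf _ = 1 from h, Finset.card_eq_one] at hs
  obtain ⟨c, rfl⟩ := hs
  rw [Finset.coe_singleton] at hs'
  have hsur : ∀ x : C, ∃ r : R, r • c = x := fun x =>
    Submodule.mem_span_singleton.1 (hs' ▸ Submodule.mem_top)
  refine ⟨(LinearEquiv.ofBijective (LinearMap.toSpanSingleton R C c) ⟨?_, hsur⟩).symm⟩
  rw [injective_iff_map_eq_zero]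
  intro r hr
  refine ann_zero hC fun x => ?_
  obtain ⟨t, rfl⟩ := hsur x
  rw [LinearMap.toSpanSingleton_apply] at hr
  rw [smul_comm, hr, smul_zero]

theorem iso_K {n : ℕ} {J : Ideal R} (hJ : Reg R n J)
    (hmax : ∀ p : Ideal R, p.IsPrime → J ≤ p → p = maximalIdeal R) (hK : IsCanonicalModule R K)
    (hC : IsSemidualizing R C)
    (h : Module.finrank (R ⧸ maximalIdeal R) (S R (Q J C)) = 1) : Nonempty (C ≃ₗ[R] K) := by
  have := hK.1.1
  have := hC.1
  have := QC_nontrivial hJ hK.1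
  have := QC_nontrivial hJ hC
  have hkillK : ∀ r ∈ J, ∀ m : Q J K, r • m = 0 := fun r hr m => mem_smul_of_Q hr m
  have hkillC : ∀ r ∈ J, ∀ m : Q J C, r • m = 0 := fun r hr m => mem_smul_of_Q hr m
  obtain ⟨z0, hz00, hz0⟩ := exists_socle hmax (Q J K) hkillK
  obtain ⟨v, hv0, hv⟩ := exists_socle hmax (Q J C) hkillC
  have hgen : ∀ w ∈ S R (Q J C), ∃ r : R, w = r • v := by
    intro w hw
    letI : Field (R ⧸ maximalIdeal R) := Ideal.Quotient.field _
    obtain ⟨c, hc⟩ := (finrank_eq_one_iff_of_nonzero' (⟨v, mem_S.2 hv⟩ : S R (Q J C))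
      (fun h => hv0 (congrArg Subtype.val h))).1 h ⟨w, hw⟩
    obtain ⟨r, rfl⟩ := Ideal.Quotient.mk_surjective c
    exact ⟨r, (congrArg Subtype.val hc).symm⟩
  obtain ⟨f, hf, hf'⟩ := exists_kmap hv0 hv
  obtain ⟨g, hg, hg'⟩ := exists_kmap hz00 hz0
  obtain ⟨ι, hι⟩ := inj_ext hJ hmax hK hkillC f hf g
  have hιv : ι v = z0 := by
    have := hι (Submodule.Quotient.mk 1)
    rwa [hf', hg', one_smul, one_smul] at this
  have hinj : Function.Injective ι := by
    rw [← LinearMap.ker_eq_bot]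
    by_contra hne
    have : Nontrivial (LinearMap.ker ι) := Submodule.nontrivial_iff_ne_bot.2 hne
    obtain ⟨z, hz1, hz⟩ := exists_socle hmax (LinearMap.ker ι)
      fun r hr m => Subtype.ext (hkillC r hr m)
    obtain ⟨r, hr⟩ := hgen z (mem_S.2 fun r hr => congrArg Subtype.val (hz r hr))
    have h2 : r • z0 = 0 := by rw [← hιv, ← map_smul, ← hr]; exact z.2
    have h3 : r ∈ maximalIdeal R := by
      by_contra hr'
      have hu : IsUnit r := by simpa using hr'
      exact hz00 (hu.smul_eq_zero.1 h2)
    exact hz1 (Subtype.ext (hr.trans (hv r h3)))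
  have hsur : Function.Surjective ι := by
    rw [← LinearMap.range_eq_top]
    by_contra hne
    have : Nontrivial (Q J K ⧸ LinearMap.range ι) := Submodule.Quotient.nontrivial_iff.2 hne
    have hkX : ∀ r ∈ J, ∀ m : Q J K ⧸ LinearMap.range ι, r • m = 0 := by
      intro r hr m
      obtain ⟨m, rfl⟩ := Submodule.mkQ_surjective _ m
      rw [← map_smul, hkillK r hr, map_zero]
    obtain ⟨z, hz1, hz⟩ := exists_socle hmax _ hkX
    obtain ⟨p, hp, hp'⟩ := exists_kmap hz1 hz
    obtain ⟨φ, hφ⟩ := inj_ext hJ hmax hK hkX p hp g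
    have hφz : φ z = z0 := by
      have := hφ (Submodule.Quotient.mk 1)
      rwa [hp', hg', one_smul, one_smul] at this
    obtain ⟨r, hr⟩ := (SDJ.of hJ hK.1).sur (φ ∘ₗ Submodule.mkQ _ ∘ₗ qm J)
    have hr2 : ∀ y : Q J K, φ (Submodule.mkQ _ y) = r • y := by
      intro y
      obtain ⟨k, rfl⟩ := mk_surj J y
      exact hr k
    have hrJ : r ∈ J := by
      refine (SDJ.of hJ hC).inj r fun c => hinj ?_
      rw [map_smul, ← hr2, map_zero]
      have : Submodule.mkQ (LinearMap.range ι) (ι (qm J c)) = 0 := by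
        rw [Submodule.mkQ_apply, Submodule.Quotient.mk_eq_zero]
        exact ⟨_, rfl⟩
      rw [this, map_zero]
    obtain ⟨y, rfl⟩ := Submodule.mkQ_surjective _ z
    rw [hr2, hkillK r hrJ] at hφz
    exact hz00 hφz.symm
  obtain ⟨w, hw⟩ := lift_hom hJ hK.1 (van_CK hJ hmax hK hC) (ι ∘ₗ qm J)
  have hw' : ∀ c, qm J (w c) = ι (qm J c) := fun c => congrArg (fun f => f c) hw
  refine ⟨LinearEquiv.ofBijective w ⟨inj_of_inj hJ hK.1 w fun c hc => hinj ?_, ?_⟩⟩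
  · rw [← hw', hc, map_zero]
  · rw [← LinearMap.range_eq_top, eq_top_iff]
    refine Submodule.le_of_le_smul_of_le_jacobson_bot (I := J) (hK.1.1.1)
      (hJ.le.trans (IsLocalRing.maximalIdeal_le_jacobson _)) ?_
    intro k _
    obtain ⟨y, hy⟩ := hsur (qm J k)
    obtain ⟨c, rfl⟩ := mk_surj J y
    have h2 : qm J (k - w c) = 0 := by rw [map_sub, hw', hy, sub_self]
    rw [Submodule.mkQ_apply, Submodule.Quotient.mk_eq_zero] at h2
    rw [← add_sub_cancel (w c) k]
    exact Submodule.add_mem_sup ⟨c, rfl⟩ h2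

end
end SDP

/-- If the Cohen-Macaulay type of R (the minimal number of generators of the
canonical module K) is a prime number, then every semidualizing module is trivial. -/
theorem semidualizing_trivial_of_type_prime (R : Type) [CommRing R] [IsNoetherianRing R]
    [IsLocalRing R] (hCM : IsCMLocal R)
    (K : Type) [AddCommGroup K] [Module R K] (hK : IsCanonicalModule R K)
    (hprime : (mu R K).Prime)
    (C : Type) [AddCommGroup C] [Module R C] (hC : IsSemidualizing R C) :
    Nonempty (C ≃ₗ[R] R) ∨ Nonempty (C ≃ₗ[R] K) := by

  have := hK.1.1
  have := hC.1
  obtain ⟨d, J, hJ, hmax⟩ := SDP.exists_J hCM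
  have h1 := SDP.count hJ hK.1
  rw [SDP.tK hJ hmax hK, mul_one, ← SDP.mu_eq, SDP.count hJ hC, ← SDP.mu_eq] at h1
  rw [← h1, Nat.prime_mul_iff] at hprime
  rcases hprime with ⟨_, h⟩ | ⟨_, h⟩
  · exact Or.inr (SDP.iso_K hJ hmax hK hC h)
  · exact Or.inl (SDP.iso_R hC h)
end

section
/- Let R be a commutative Noetherian local ring, f ∈ R[x] a monic polynomial of positive degree with constant data making R[x]/(f) local, and suppose R[x]/(f) has only trivial semidualizing modules. If R is Cohen–Macaulay local with canonical module and R → R[x]/(f) is a faithfully flat local homomorphism of Cohen–Macaulay local rings, then R has only trivial semidualizing modules. -/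
open CategoryTheory IsLocalRing

/-- A local ring has only trivial semidualizing modules: every semidualizing module is
isomorphic to the ring or to a canonical module. -/
def HasOnlyTrivialSemidualizing (R : Type) [CommRing R] [IsLocalRing R] : Prop :=
  ∀ (K : Type) [AddCommGroup K] [Module R K], IsCanonicalModule R K →
    ∀ (C : Type) [AddCommGroup C] [Module R C], IsSemidualizing R C →
      Nonempty (C ≃ₗ[R] R) ∨ Nonempty (C ≃ₗ[R] K)


lemma ext_subsingleton_iff {R : Type} [CommRing R] {M : ModuleCat.{0} R}
    (P : ProjectiveResolution M) (N : ModuleCat.{0} R) (i : ℕ) :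
    Subsingleton (((Ext R (ModuleCat.{0} R) (i+1)).obj (Opposite.op M)).obj N) ↔
      ∀ φ : P.complex.X (i+1) ⟶ N, P.complex.d (i+2) (i+1) ≫ φ = 0 →
        ∃ ψ : P.complex.X i ⟶ N, P.complex.d (i+1) i ≫ ψ = φ := by
  rw [(P.isoExt (R := R) (i+1) N).toLinearEquiv.toEquiv.subsingleton_congr]
  rw [← ModuleCat.isZero_iff_subsingleton, ← HomologicalComplex.exactAt_iff_isZero_homology,
    HomologicalComplex.exactAt_iff' _ i (i+1) (i+2) (by simp) (by simp),
    ShortComplex.moduleCat_exact_iff]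
  rfl

lemma ext_coind {R S : Type} [CommRing R] [CommRing S] (f : R →+* S)
    [(ModuleCat.restrictScalars.{0} f).PreservesProjectiveObjects]
    (M : ModuleCat.{0} S) (N : ModuleCat.{0} R) (i : ℕ)
    (h : Subsingleton (((Ext R (ModuleCat.{0} R) (i+1)).obj
      (Opposite.op ((ModuleCat.restrictScalars f).obj M))).obj N)) :
    Subsingleton (((Ext S (ModuleCat.{0} S) (i+1)).obj
      (Opposite.op M)).obj ((ModuleCat.coextendScalars f).obj N)) := by
  let P := projectiveResolution M
  let adj := ModuleCat.restrictCoextendScalarsAdj.{0} f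
  rw [ext_subsingleton_iff ((ModuleCat.restrictScalars f).mapProjectiveResolution P)] at h
  have h' : ∀ φ : (ModuleCat.restrictScalars f).obj (P.complex.X (i+1)) ⟶ N,
      (ModuleCat.restrictScalars f).map (P.complex.d (i+2) (i+1)) ≫ φ = 0 →
      ∃ ψ : (ModuleCat.restrictScalars f).obj (P.complex.X i) ⟶ N,
        (ModuleCat.restrictScalars f).map (P.complex.d (i+1) i) ≫ ψ = φ := h
  rw [ext_subsingleton_iff P]
  intro φ hφ
  obtain ⟨ψ, hψ⟩ := h' ((adj.homEquiv _ _).symm φ) (by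
    rw [← adj.homEquiv_naturality_left_symm, hφ]
    simp [Adjunction.homEquiv_counit])
  refine ⟨adj.homEquiv _ _ ψ, ?_⟩
  apply (adj.homEquiv _ _).symm.injective
  rw [← hψ, adj.homEquiv_naturality_left_symm, Equiv.symm_apply_apply]

lemma leftDerived_additive {C D : Type*} [Category C] [Category D] [Abelian C] [Abelian D]
    [HasProjectiveResolutions C] (F : C ⥤ D) [F.Additive] (n : ℕ) :
    (F.leftDerived n).Additive where
  map_add {X Y f g} := by
    let P := projectiveResolution X
    let Q := projectiveResolution Y
    rw [F.leftDerived_map_eq n f (ProjectiveResolution.lift f P Q) (by simp),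
      F.leftDerived_map_eq n g (ProjectiveResolution.lift g P Q) (by simp),
      F.leftDerived_map_eq n (f + g)
        (ProjectiveResolution.lift f P Q + ProjectiveResolution.lift g P Q)
        (by simp [Preadditive.add_comp, Preadditive.comp_add, Functor.map_add])]
    rw [Functor.map_add, Preadditive.add_comp, Preadditive.comp_add]

lemma ext_pi {R : Type} [CommRing R] (M N L : ModuleCat.{0} R) (n : ℕ)
    (e : L ≃ₗ[R] (Fin n → M)) (i : ℕ)
    (h : Subsingleton (((Ext R (ModuleCat.{0} R) i).obj (Opposite.op M)).obj N)) :
    Subsingleton (((Ext R (ModuleCat.{0} R) i).obj (Opposite.op L)).obj N) := by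
  let F : ModuleCat.{0} R ⥤ (ModuleCat.{0} R)ᵒᵖ :=
    (((linearYoneda R (ModuleCat.{0} R)).obj N).rightOp.leftDerived i)
  have : F.Additive := leftDerived_additive _ _
  have h1 : Limits.IsZero (F.obj M) :=
    (ModuleCat.isZero_iff_subsingleton.2 h).op
  have h2 : Limits.IsZero (F.obj L) := by
    rw [Limits.IsZero.iff_id_eq_zero]
    have : 𝟙 L = ∑ j, ModuleCat.ofHom ((LinearMap.proj j).comp e.toLinearMap) ≫
        ModuleCat.ofHom (e.symm.toLinearMap.comp (LinearMap.single R (fun _ : Fin n => M) j)) := by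
      ext x
      apply e.injective
      simp [ModuleCat.hom_sum]
      ext j
      simp [Finset.sum_apply, Pi.single_apply]
    rw [← F.map_id, this, F.map_sum]
    refine Finset.sum_eq_zero fun j _ => ?_
    rw [F.map_comp, h1.eq_zero_of_tgt (F.map _), Limits.zero_comp]
  exact ModuleCat.isZero_iff_subsingleton.1 h2.unop

lemma cancel_pow {R : Type} [CommRing R] [IsLocalRing R] {C D : Type} [AddCommGroup C]
    [AddCommGroup D] [Module R C] [Module R D] (hC : Function.Bijective (LinearMap.lsmul R C))
    (hD : Function.Bijective (LinearMap.lsmul R D)) (n : ℕ) 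
    (e : (Fin n → C) ≃ₗ[R] (Fin n → D)) (hn : 0 < n) : Nonempty (C ≃ₗ[R] D) := by
  classical
  let i0 : Fin n := ⟨0, hn⟩
  let a : Fin n → C →ₗ[R] D := fun j => LinearMap.proj j ∘ₗ e.toLinearMap ∘ₗ LinearMap.single R (fun _ : Fin n => _) i0
  let b : Fin n → D →ₗ[R] C := fun j =>
    LinearMap.proj i0 ∘ₗ e.symm.toLinearMap ∘ₗ LinearMap.single R (fun _ : Fin n => _) j
  have hab : ∑ j, b j ∘ₗ a j = LinearMap.id := by
    ext x
    have : ∑ j, Pi.single j (e (Pi.single i0 x) j) = e (Pi.single i0 x) := 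
      Finset.univ_sum_single _
    simp only [LinearMap.sum_apply, LinearMap.comp_apply, a, b, LinearMap.proj_apply,
      LinearMap.coe_single, LinearEquiv.coe_coe, LinearMap.id_apply]
    rw [← Finset.sum_apply, ← map_sum, this]
    simp
  choose r hr using fun j => hC.2 (b j ∘ₗ a j)
  have hsum : ∑ j, r j = 1 := by
    apply hC.1
    rw [map_sum]
    simp only [hr, hab]
    ext; simp
  obtain ⟨j, hj⟩ : ∃ j, IsUnit (r j) := by
    by_contra! hcon
    have : ∑ j, r j ∈ maximalIdeal R := Ideal.sum_mem _ fun j _ => hcon j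
    rw [hsum] at this
    exact (Ideal.ne_top_iff_one _).1 (maximalIdeal.isMaximal R).ne_top this
  obtain ⟨s, hs⟩ := hD.2 (a j ∘ₗ b j)
  have hba : ∀ x, b j (a j x) = r j • x := fun x => (LinearMap.congr_fun (hr j) x).symm
  have hab' : ∀ x, a j (b j x) = s • x := fun x => (LinearMap.congr_fun hs x).symm
  have hrs : s = r j := by
    obtain ⟨u, hu⟩ := hj
    have h1 : ∀ x : C, s • x = r j • x := by
      intro x
      have : b j (a j (b j (a j x))) = b j (s • a j x) := by rw [hab']
      rw [hba, hba, map_smul, hba, smul_comm s, ← hu] at this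
      rw [← hu]
      have := congrArg (fun y => (↑u⁻¹ : R) • y) this
      simpa [smul_smul] using this.symm
    apply hC.1
    ext x
    exact h1 x
  obtain ⟨u, hu⟩ := hj
  refine ⟨LinearEquiv.ofLinearMap (a j) ((↑u⁻¹ : R) • b j) ?_ ?_⟩
  · ext x
    simp [hab', hrs, ← hu, smul_smul]
  · ext x
    simp [hba, ← hu, smul_smul]

section coind

variable {R S : Type} [CommRing R] [CommRing S] [Algebra R S]

/-- The coinduced module `Hom_R(S, C)`. -/
noncomputable abbrev coind (R S C : Type) [CommRing R] [CommRing S] [Algebra R S]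
    [AddCommGroup C] [Module R C] : ModuleCat.{0} S :=
  (ModuleCat.coextendScalars (algebraMap R S)).obj (ModuleCat.of R C)

/-- An `R`-linear map seen as an element of the coinduced module. -/
noncomputable def toCoind {C : Type} [AddCommGroup C] [Module R C] (g : S →ₗ[R] C) :
    coind R S C :=
  ({ toFun := fun x => g x
     map_add' := fun x y => g.map_add x y
     map_smul' := fun r x => by
      change g (algebraMap R S r * (show S from x)) = r • g x
      rw [← Algebra.smul_def, map_smul] } :
    (ModuleCat.restrictScalars (algebraMap R S)).obj (ModuleCat.of S S) →ₗ[R] C)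

/-- An element of the coinduced module seen as an `R`-linear map. -/
noncomputable def ofCoind {C : Type} [AddCommGroup C] [Module R C] (h : coind R S C) :
    S →ₗ[R] C where
  toFun x := h x
  map_add' x y := (ModuleCat.CoextendScalars.equiv _ _ h).map_add x y
  map_smul' r x := by
    rw [Algebra.smul_def]
    exact (ModuleCat.CoextendScalars.equiv _ _ h).map_smul r x

variable {C : Type} [AddCommGroup C] [Module R C]

lemma ofCoind_toCoind (g : S →ₗ[R] C) : ofCoind (toCoind g) = g := rfl

lemma toCoind_ofCoind (g : coind R S C) : toCoind (ofCoind g) = g := rfl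

lemma ofCoind_add (g h : coind R S C) : ofCoind (g + h) = ofCoind g + ofCoind h := rfl

lemma ofCoind_smul (s : S) (g : coind R S C) (t : S) : ofCoind (s • g) t = ofCoind g (t * s) := rfl

lemma ofCoind_inj {g h : coind R S C} (H : ∀ t, ofCoind g t = ofCoind h t) : g = h := by
  rw [← toCoind_ofCoind g, ← toCoind_ofCoind h, LinearMap.ext H]

/-- The coinduced module is a power of `C` as an `R`-module. -/
noncomputable def coindEquiv {n : ℕ} (b : Module.Basis (Fin n) R S) :
    (ModuleCat.restrictScalars (algebraMap R S)).obj (coind R S C) ≃ₗ[R] (Fin n → C) where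
  toFun h j := ofCoind (R := R) (S := S) (C := C) h (b j)
  map_add' _ _ := rfl
  map_smul' r h := by
    ext j
    change ofCoind (algebraMap R S r • (show coind R S C from h)) (b j) = _
    rw [ofCoind_smul, mul_comm, ← Algebra.smul_def, map_smul]
    rfl
  invFun v := toCoind (R := R) (S := S) (C := C) (b.constr R v)
  left_inv h := by
    refine ofCoind_inj (R := R) (S := S) (C := C) fun t => LinearMap.congr_fun ?_ t
    rw [ofCoind_toCoind]
    exact b.ext fun j => by simp
  right_inv v := by
    ext j
    change ofCoind (toCoind (b.constr R v)) (b j) = v j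
    rw [ofCoind_toCoind]
    simp

lemma coind_finite {n : ℕ} (b : Module.Basis (Fin n) R S) [Module.Finite R C] :
    Module.Finite S (coind R S C) := by
  let : Module R (coind R S C) := Module.compHom _ (algebraMap R S)
  have : IsScalarTower R S (coind R S C) := ⟨fun r s x => by
    rw [Algebra.smul_def, mul_smul]; rfl⟩
  have : Module.Finite R (coind R S C) :=
    Module.Finite.equiv (coindEquiv (C := C) b).symm
  exact Module.Finite.of_restrictScalars_finite R S _

lemma coind_lsmul {n : ℕ} (b : Module.Basis (Fin n) R S)
    (hC : Function.Bijective (LinearMap.lsmul R C)) :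
    Function.Bijective (LinearMap.lsmul S (coind R S C)) := by
  constructor
  · rw [injective_iff_map_eq_zero]
    intro s hs
    apply b.ext_elem
    intro j
    apply hC.1
    ext c
    have := LinearMap.congr_fun hs (toCoind ((b.coord j).smulRight c))
    have := congrArg (fun h => ofCoind h 1) this
    have h2 : ofCoind (s • toCoind ((b.coord j).smulRight c)) 1 = 0 := this
    rw [ofCoind_smul, ofCoind_toCoind] at h2
    simpa using h2
  · intro T
    have hsm : ∀ (r : R) (g : S →ₗ[R] C), toCoind (r • g) = algebraMap R S r • toCoind g := by
      intro r g
      refine ofCoind_inj fun t => ?_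
      rw [ofCoind_smul, ofCoind_toCoind, ofCoind_toCoind, mul_comm, ← Algebra.smul_def, map_smul]
      rfl
    let τ : (S →ₗ[R] C) →ₗ[R] C :=
      { toFun := fun g => ofCoind (T (toCoind g)) 1
        map_add' := fun g h => by
          have : toCoind (g + h) = toCoind g + toCoind h := rfl
          rw [this, map_add, ofCoind_add]; rfl
        map_smul' := fun r g => by
          rw [hsm, map_smul, ofCoind_smul, mul_comm, ← Algebra.smul_def, map_smul]; rfl }
    choose r hr using fun j => hC.2 (τ ∘ₗ LinearMap.smulRightₗ (b.coord j))
    have hτ : ∀ g, τ g = g (∑ j, r j • b j) := by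
      intro g
      have hg : g = ∑ j, LinearMap.smulRightₗ (b.coord j) (g (b j)) := by
        refine b.ext fun i => ?_
        simp [LinearMap.sum_apply, Finsupp.single_apply]
      conv_lhs => rw [hg]
      rw [map_sum, map_sum]
      refine Finset.sum_congr rfl fun j _ => ?_
      rw [map_smul]
      exact (LinearMap.congr_fun (hr j) (g (b j))).symm
    refine ⟨∑ j, r j • b j, ?_⟩
    ext1 g
    refine ofCoind_inj fun t => ?_
    have h1 := hτ (ofCoind (t • g))
    have h2 : τ (ofCoind (t • g)) = ofCoind (t • T g) 1 := by
      rw [← map_smul]; rfl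
    rw [h2, ofCoind_smul, ofCoind_smul, one_mul] at h1
    rw [h1, LinearMap.lsmul_apply, ofCoind_smul, mul_comm]

lemma restrict_preservesProjective [Module.Projective R S] :
    (ModuleCat.restrictScalars.{0} (algebraMap R S)).PreservesProjectiveObjects where
  projective_obj {P} hP := by
    have : (ModuleCat.coextendScalars.{0} (algebraMap R S)).PreservesEpimorphisms := ⟨by
      intro X Y g hg
      rw [ModuleCat.epi_iff_surjective] at hg ⊢
      intro y
      obtain ⟨h, hh⟩ := Module.projective_lifting_property g.hom
        (ofCoind (R := R) (S := S) (C := Y) y) hg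
      refine ⟨toCoind h, ?_⟩
      exact ofCoind_inj (R := R) (S := S) (C := Y) fun t => LinearMap.congr_fun hh t⟩
    exact (ModuleCat.restrictCoextendScalarsAdj.{0} (algebraMap R S)).map_projective P hP

lemma coind_semidualizing {n : ℕ} (b : Module.Basis (Fin n) R S) (hC : IsSemidualizing R C) :
    IsSemidualizing S (coind R S C) := by
  obtain ⟨h1, h2, h3⟩ := hC
  have := Module.Free.of_basis b
  have := restrict_preservesProjective (R := R) (S := S)
  refine ⟨coind_finite b, coind_lsmul b h2, fun i hi => ?_⟩
  obtain ⟨i, rfl⟩ := Nat.exists_eq_succ_of_ne_zero hi.ne'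
  exact ext_coind (algebraMap R S) (coind R S C) (ModuleCat.of R C) i
    (ext_pi (ModuleCat.of R C) _ _ n (coindEquiv b) _ (h3 _ hi))

lemma coind_canonical {n : ℕ} (b : Module.Basis (Fin n) R S) (hC : IsCanonicalModule R C) :
    IsCanonicalModule S (coind R S C) := by
  refine ⟨coind_semidualizing b hC.1, ?_⟩
  have := Module.Free.of_basis b
  have := restrict_preservesProjective (R := R) (S := S)
  obtain ⟨m, hm⟩ := hC.2
  refine ⟨m, fun M _ _ i hi => ?_⟩
  obtain ⟨i, rfl⟩ := Nat.exists_eq_succ_of_ne_zero (Nat.ne_zero_of_lt hi)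
  exact ext_coind (algebraMap R S) (ModuleCat.of S M) (ModuleCat.of R C) i
    (hm ((ModuleCat.restrictScalars (algebraMap R S)).obj (ModuleCat.of S M)) _ hi)

lemma lsmul_self_bijective (R : Type) [CommRing R] : Function.Bijective (LinearMap.lsmul R R) := by
  constructor
  · intro a b h
    simpa using LinearMap.congr_fun h 1
  · intro T
    refine ⟨T 1, ?_⟩
    ext
    simp

lemma descent_aux [IsLocalRing R] [IsLocalRing S] {n : ℕ} (b : Module.Basis (Fin n) R S)
    (hn : 0 < n) (hS : HasOnlyTrivialSemidualizing S) : HasOnlyTrivialSemidualizing R := by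
  intro K _ _ hK C _ _ hC
  rcases hS _ (coind_canonical b hK) _ (coind_semidualizing b hC) with ⟨⟨e⟩⟩ | ⟨⟨e⟩⟩
  · left
    have e1 := ((ModuleCat.restrictScalars (algebraMap R S)).mapIso
      (e.toModuleIso : coind R S C ≅ ModuleCat.of S S)).toLinearEquiv
    have e2 : (ModuleCat.restrictScalars (algebraMap R S)).obj (ModuleCat.of S S) ≃ₗ[R] S :=
      { toFun := fun x => x
        invFun := fun x => x
        map_add' := fun _ _ => rfl
        map_smul' := fun r x => (Algebra.smul_def r (show S from x)).symm
        left_inv := fun _ => rfl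
        right_inv := fun _ => rfl }
    exact cancel_pow hC.2.1 (lsmul_self_bijective R) n
      ((coindEquiv b).symm ≪≫ₗ e1 ≪≫ₗ e2 ≪≫ₗ b.equivFun) hn
  · right
    have e1 := ((ModuleCat.restrictScalars (algebraMap R S)).mapIso
      (e.toModuleIso : coind R S C ≅ coind R S K)).toLinearEquiv
    exact cancel_pow hC.2.1 hK.1.2.1 n
      ((coindEquiv b).symm ≪≫ₗ e1 ≪≫ₗ coindEquiv b) hn

end coind

/-- Descent of triviality of semidualizing modules along R → R[x]/(f) for a monic
polynomial f: if the Cohen-Macaulay local ring R[x]/(f) has only trivial semidualizing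
modules and R → R[x]/(f) is a faithfully flat local homomorphism of Cohen-Macaulay
local rings (R having a canonical module), then R has only trivial semidualizing
modules. -/
theorem descent_along_monic_quotient (R : Type) [CommRing R] [IsNoetherianRing R]
    [IsLocalRing R]
    (f : Polynomial R) (hf : f.Monic) (hdeg : 0 < f.natDegree)
    [IsLocalRing (Polynomial R ⧸ Ideal.span {f})]
    (hCMR : IsCMLocal R) (hCMS : IsCMLocal (Polynomial R ⧸ Ideal.span {f}))
    (K : Type) [AddCommGroup K] [Module R K] (hK : IsCanonicalModule R K)
    (hflat : Module.FaithfullyFlat R (Polynomial R ⧸ Ideal.span {f}))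
    (hloc : IsLocalHom (algebraMap R (Polynomial R ⧸ Ideal.span {f})))
    (hS : HasOnlyTrivialSemidualizing (Polynomial R ⧸ Ideal.span {f})) :
    HasOnlyTrivialSemidualizing R := by
  have := hf.finite_quotient
  have := hf.free_quotient
  exact descent_aux (Module.finBasis R (Polynomial R ⧸ Ideal.span {f})) ((Module.finrank_pos_iff_of_free R _).2 inferInstance) hS
end
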